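/- arXiv:2409.20088 — 2 statements merged into one kernel-verified Lean document; each statement's English description precedes it below -/
import Mathlib

section
/- Suppose char K ≠ 2 and dim V ≡ 2 (mod 4). Let φ ∈ SO(V,Q). Then φ is a product of two involutions of SO(V,Q) if and only if φ has an orthogonal summand of odd dimension, i.e. there exists a φ-invariant subspace U of V of odd dimension on which the restriction of f_Q is nondegenerate. -/
open Polynomial Module

variable {K V : Type*}

section Defs

variable [Field K] [AddCommGroup V] [Module K V]

/-- The polar form `f_Q(u,w) = Q(u+w) - Q u - Q w` of a quadratic form. -/
def polarF (Q : QuadraticForm K V) (u w : V) : K := Q (u + w) - Q u - Q w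

/-- `Q` is nondefective: its polar form is nondegenerate. -/
def Nondefective (Q : QuadraticForm K V) : Prop :=
  ∀ u : V, (∀ w : V, polarF Q u w = 0) → u = 0

/-- Membership in the orthogonal group `O(V,Q)`. -/
def InO (Q : QuadraticForm K V) (φ : V ≃ₗ[K] V) : Prop := ∀ v : V, Q (φ v) = Q v

/-- Membership in the special orthogonal group `SO(V,Q)`:
orthogonal and `dim im(φ - 1)` is even. -/
def InSO (Q : QuadraticForm K V) (φ : V ≃ₗ[K] V) : Prop :=
  InO Q φ ∧ Even (Module.finrank K (LinearMap.range (φ.toLinearMap - LinearMap.id)))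

/-- `φ` is a product of two involutions of `SO(V,Q)`. -/
def BireflSO (Q : QuadraticForm K V) (φ : V ≃ₗ[K] V) : Prop :=
  ∃ σ τ : V ≃ₗ[K] V, InSO Q σ ∧ InSO Q τ ∧ σ * σ = 1 ∧ τ * τ = 1 ∧ φ = σ * τ

/-- A subspace is totally isotropic if `Q` vanishes on it. -/
def TotIsotropic (Q : QuadraticForm K V) (U : Submodule K V) : Prop := ∀ u ∈ U, Q u = 0

/-- A subspace invariant under a linear map. -/
def Invariant (f : V →ₗ[K] V) (U : Submodule K V) : Prop := ∀ u ∈ U, f u ∈ U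

/-- The restriction of the polar form of `Q` to `U` is nondegenerate. -/
def NondegOn (Q : QuadraticForm K V) (U : Submodule K V) : Prop :=
  ∀ u ∈ U, (∀ w ∈ U, polarF Q u w = 0) → u = 0

/-- `f` is orthogonally indecomposable: no invariant subspace `W` with
`0 < dim W < dim V` on which the polar form of `Q` is nondegenerate. -/
def OrthIndec (Q : QuadraticForm K V) (f : V →ₗ[K] V) : Prop :=
  ¬ ∃ W : Submodule K V, Invariant f W ∧ 0 < Module.finrank K W ∧
      Module.finrank K W < Module.finrank K V ∧ NondegOn Q W

/-- The subspace spanned by the `f`-orbit of `x`. -/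
def cyclicSpan (f : V →ₗ[K] V) (x : V) : Submodule K V :=
  Submodule.span K (Set.range fun k : ℕ => (f ^ k) x)

/-- `f` is a cyclic linear map. -/
def IsCyclicEnd (f : V →ₗ[K] V) : Prop := ∃ x : V, cyclicSpan f x = ⊤

/-- `f` is of type 1 with exponent `m`: orthogonally indecomposable, bicyclic, and
with minimal polynomial `(X - 1) ^ m`. -/
def IsType1 (Q : QuadraticForm K V) (f : V →ₗ[K] V) (m : ℕ) : Prop :=
  OrthIndec Q f ∧ 1 ≤ m ∧ minpoly K f = (X - 1) ^ m ∧
    ∃ x z : V, IsCompl (cyclicSpan f x) (cyclicSpan f z)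

/-- Type 1o: type 1 with odd exponent. -/
def IsType1o (Q : QuadraticForm K V) (f : V →ₗ[K] V) : Prop :=
  ∃ m : ℕ, IsType1 Q f m ∧ Odd m

/-- Type 1e: type 1 with even exponent. -/
def IsType1e (Q : QuadraticForm K V) (f : V →ₗ[K] V) : Prop :=
  ∃ m : ℕ, IsType1 Q f m ∧ Even m

/-- The quadratic space `(V,Q)` is hyperbolic. -/
def HyperbolicSpace (Q : QuadraticForm K V) : Prop :=
  ∃ U W : Submodule K V, TotIsotropic Q U ∧ TotIsotropic Q W ∧ IsCompl U W

/-- The transformation `f` is hyperbolic: `V` is a direct sum of two totally isotropic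
`f`-invariant subspaces. -/
def HyperbolicMap (Q : QuadraticForm K V) (f : V →ₗ[K] V) : Prop :=
  ∃ U W : Submodule K V, TotIsotropic Q U ∧ TotIsotropic Q W ∧
    Invariant f U ∧ Invariant f W ∧ IsCompl U W

/-- `f` is semisimple: every invariant subspace has an invariant complement. -/
def SemisimpleEnd (f : V →ₗ[K] V) : Prop :=
  ∀ U : Submodule K V, Invariant f U → ∃ W : Submodule K V, Invariant f W ∧ IsCompl U W

end Defs

section Isometries

variable [Field K] [AddCommGroup V] [Module K V]

/-- `φ` is an isometry, with inverse `ψ`, of the nondegenerate symmetric bilinear form `B`. -/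
structure IsometryPair (B : LinearMap.BilinForm K V) (φ ψ : End K V) : Prop where
  symm : ∀ u w, B u w = B w u
  nondeg : ∀ u, (∀ w, B u w = 0) → u = 0
  mul_inv : φ * ψ = 1
  inv_mul : ψ * φ = 1
  adj : ∀ u w, B (φ u) w = B u (ψ w)

namespace IsometryPair

variable {B : LinearMap.BilinForm K V} {φ ψ : End K V}

lemma apply_inv (h : IsometryPair B φ ψ) (v : V) : φ (ψ v) = v :=
  LinearMap.congr_fun h.mul_inv v

lemma inv_apply (h : IsometryPair B φ ψ) (v : V) : ψ (φ v) = v :=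
  LinearMap.congr_fun h.inv_mul v

lemma adj' (h : IsometryPair B φ ψ) (u w : V) : B (ψ u) w = B u (φ w) := by
  rw [h.symm, ← h.adj, h.symm]

lemma commute (h : IsometryPair B φ ψ) : Commute φ ψ := by
  rw [Commute, SemiconjBy, h.mul_inv, h.inv_mul]

lemma inv_mem [FiniteDimensional K V] (h : IsometryPair B φ ψ) {W : Submodule K V}
    (hW : ∀ w ∈ W, φ w ∈ W) : ∀ w ∈ W, ψ w ∈ W := by
  intro w hw
  have hinj : Function.Injective (φ.restrict hW) := fun a b hab => by
    have := congrArg (fun x : W => ψ (x : V)) hab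
    simpa [h.inv_apply] using this
  obtain ⟨a, ha⟩ := LinearMap.surjective_of_injective hinj ⟨w, hw⟩
  have : φ a = w := congrArg Subtype.val ha
  rw [← this, h.inv_apply]
  exact a.2

end IsometryPair

/-- The cyclic subspace `K[f] u`. -/
noncomputable def polySpan (f : End K V) (u : V) : Submodule K V :=
  LinearMap.range ((aeval f).toLinearMap.flip u)

lemma mem_polySpan {f : End K V} {u v : V} :
    v ∈ polySpan f u ↔ ∃ p : K[X], aeval f p u = v := Iff.rfl

lemma self_mem_polySpan (f : End K V) (u : V) : u ∈ polySpan f u :=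
  ⟨1, by simp⟩

lemma aeval_mem_polySpan {f : End K V} {u v : V} (hv : v ∈ polySpan f u) (p : K[X]) :
    aeval f p v ∈ polySpan f u := by
  obtain ⟨q, rfl⟩ := mem_polySpan.1 hv
  exact mem_polySpan.2 ⟨p * q, by simp⟩

lemma apply_mem_polySpan {f : End K V} {u v : V} (hv : v ∈ polySpan f u) :
    f v ∈ polySpan f u := by
  simpa using aeval_mem_polySpan hv X

lemma aeval_mem_of_invariant {f : End K V} {W : Submodule K V} (hW : ∀ w ∈ W, f w ∈ W) (p : K[X])
    {w : V} (hw : w ∈ W) : aeval f p w ∈ W := by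
  induction p using Polynomial.induction_on' with
  | add p q hp hq => simpa using W.add_mem hp hq
  | monomial n a =>
    rw [aeval_monomial, ← Algebra.smul_def, LinearMap.smul_apply]
    refine W.smul_mem _ ?_
    induction n with
    | zero => simpa
    | succ n ih => rw [pow_succ']; exact hW _ ih

lemma polySpan_le {f : End K V} {W : Submodule K V} {u : V} (hW : ∀ w ∈ W, f w ∈ W)
    (hu : u ∈ W) : polySpan f u ≤ W := by
  rintro v ⟨p, rfl⟩
  exact aeval_mem_of_invariant hW p hu

/-- If `q` is irreducible, `q(f)^(k+1)` kills `u` and `B (q(f)^k u) u ≠ 0`, then any `p(f) u`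
orthogonal to the cyclic space of `u` is given by a multiple `p` of `q^(k+1)`. -/
lemma pow_dvd_of_orthogonal {B : LinearMap.BilinForm K V} {f : End K V} {u w : V} {q : K[X]}
    (hq : Irreducible q) {k : ℕ} (h0 : aeval f (q ^ (k + 1)) u = 0)
    (h1 : B (aeval f (q ^ k) u) w ≠ 0) {p : K[X]}
    (hp : ∀ r : K[X], B (aeval f (r * p) u) w = 0) : q ^ (k + 1) ∣ p := by
  suffices ∀ j ≤ k + 1, q ^ j ∣ p from this _ le_rfl
  intro j
  induction j with
  | zero => simp
  | succ j ih =>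
    intro hj
    obtain ⟨a, rfl⟩ := ih (by lia)
    by_contra hdvd
    have ha : ¬ q ∣ a := fun hqa => hdvd (by rw [pow_succ]; exact mul_dvd_mul_left _ hqa)
    obtain ⟨s, t, hst⟩ := ((hq.coprime_iff_not_dvd).2 ha).pow_left (m := k + 1)
    apply h1
    have := hp (q ^ (k - j) * t)
    have e : q ^ (k - j) * t * (q ^ j * a) = q ^ k - (s * q ^ k) * q ^ (k + 1) := by
      have : q ^ k = q ^ (k - j) * q ^ j := by rw [← pow_add]; congr 1; lia
      linear_combination q ^ k * hst - t * a * this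
    rwa [e, map_sub, map_mul, LinearMap.sub_apply, Module.End.mul_apply, h0, map_zero,
      sub_zero] at this

lemma exists_self_ne_zero {B : V → V → K} (h2 : (2 : K) ≠ 0)
    (W : Submodule K V)
    (hadd : ∀ u v w, B (u + v) w = B u w + B v w) (hadd' : ∀ u v w, B u (v + w) = B u v + B u w)
    (hsymm : ∀ u ∈ W, ∀ w ∈ W, B u w = B w u) {a b : V} (ha : a ∈ W) (hb : b ∈ W)
    (hab : B a b ≠ 0) : ∃ v ∈ W, B v v ≠ 0 := by
  by_contra! H
  have h := H (a + b) (W.add_mem ha hb)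
  rw [hadd, hadd', hadd', H a ha, H b hb, hsymm b hb a ha] at h
  exact hab ((mul_eq_zero.1 (show 2 * B a b = 0 by linear_combination h)).resolve_left h2)

lemma finrank_polySpan {f : End K V} {u : V} {q : K[X]} {k : ℕ} (h0 : aeval f (q ^ k) u = 0)
    (h : ∀ p : K[X], aeval f p u = 0 → q ^ k ∣ p) :
    finrank K (polySpan f u) = (q ^ k).natDegree := by
  have hker : LinearMap.ker ((aeval f).toLinearMap.flip u) =
      (Ideal.span {q ^ k}).restrictScalars K := by
    ext p
    rw [LinearMap.mem_ker, Submodule.restrictScalars_mem, Ideal.mem_span_singleton]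
    refine ⟨fun hp => h p hp, ?_⟩
    rintro ⟨r, rfl⟩
    change aeval f (q ^ k * r) u = 0
    rw [mul_comm, map_mul, Module.End.mul_apply, h0, map_zero]
  exact (LinearMap.quotKerEquivRange _).finrank_eq.symm.trans
    ((Submodule.quotEquivOfEq _ _ hker).finrank_eq.trans finrank_quotient_span_eq_natDegree)

lemma pow_apply_of_commute {D E : End K V} (hc : Commute E D) {c : K}
    (hE : ∀ z, D z = 0 → E z = c • z) {j : ℕ} {v : V} (hv : (D ^ (j + 1)) v = 0) :
    ((E * D) ^ j) v = c ^ j • (D ^ j) v := by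
  have key : ∀ i : ℕ, (E ^ i) ((D ^ j) v) = c ^ i • (D ^ j) v := by
    intro i
    induction i with
    | zero => simp
    | succ i ih =>
      rw [pow_succ', Module.End.mul_apply, ih, map_smul, hE _ (by rwa [pow_succ'] at hv),
        smul_smul, pow_succ]
  rw [hc.mul_pow, Module.End.mul_apply, key]

end Isometries

namespace IsometryPair

variable [Field K] [AddCommGroup V] [Module K V]
  {B : LinearMap.BilinForm K V} {φ ψ : End K V}

lemma adj_pow {T T' : End K V} (hT : ∀ u w, B (T u) w = B u (T' w)) (j : ℕ) (u w : V) :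
    B ((T ^ j) u) w = B u ((T' ^ j) w) := by
  induction j generalizing u with
  | zero => simp
  | succ j ih => rw [pow_succ, pow_succ', Module.End.mul_apply, ih, hT, Module.End.mul_apply]

lemma adj_sub (h : IsometryPair B φ ψ) (ε : K) (u w : V) :
    B ((φ - ε • 1) u) w = B u ((ψ - ε • 1) w) := by
  simp [h.adj]

lemma skew (h : IsometryPair B φ ψ) (u w : V) : B ((φ - ψ) u) w = -B u ((φ - ψ) w) := by
  simp [h.adj, h.adj']

lemma adj_pow_of_ker (h : IsometryPair B φ ψ) {ε : K} (hε : ε * ε = 1) {j : ℕ} {u w : V}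
    (hw : ((φ - ε • 1) ^ (j + 1)) w = 0) :
    B (((φ - ε • 1) ^ j) u) w = (-1) ^ j * B u (((φ - ε • 1) ^ j) w) := by
  have e : ψ - ε • 1 = (-ε • ψ) * (φ - ε • 1) := by
    rw [mul_sub, smul_mul_assoc, h.inv_mul, mul_smul_comm, mul_one, smul_smul]
    simp only [mul_neg, hε]
    module
  have hc : Commute (-ε • ψ) (φ - ε • 1) :=
    ((h.commute.symm).sub_right ((Commute.one_right ψ).smul_right ε)).smul_left _
  rw [adj_pow (h.adj_sub ε), e, pow_apply_of_commute hc (c := -1) _ hw, map_smul, smul_eq_mul]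
  intro z hz
  have hz' : φ z = ε • z := by simpa [sub_eq_zero] using hz
  have : ε • ψ z = z := by rw [← map_smul, ← hz', h.inv_apply]
  simp [this]

lemma apply_mem_orthogonal [FiniteDimensional K V] (h : IsometryPair B φ ψ) {U : Submodule K V}
    (hU : ∀ u ∈ U, φ u ∈ U) : ∀ v ∈ B.orthogonal U, φ v ∈ B.orthogonal U := by
  intro v hv n hn
  change B n (φ v) = 0
  rw [← h.adj']
  exact hv _ (h.inv_mem hU n hn)

lemma aeval_sub_pow (f : End K V) (ε : K) (k : ℕ) :
    aeval f ((X - C ε) ^ k) = (f - ε • 1) ^ k := by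
  simp [Algebra.algebraMap_eq_smul_one]

lemma eq_zero_of_mem_polySpan [FiniteDimensional K V] (h : IsometryPair B φ ψ) {ε : K} {j : ℕ}
    {u : V} (h0 : ((φ - ε • 1) ^ (j + 1)) u = 0) (h1 : B (((φ - ε • 1) ^ j) u) u ≠ 0)
    {v : V} (hv : v ∈ polySpan φ u) (hv' : ∀ w ∈ polySpan φ u, B v w = 0) : v = 0 := by
  obtain ⟨p, rfl⟩ := mem_polySpan.1 hv
  have hdvd : (X - C ε) ^ (j + 1) ∣ p := by
    refine pow_dvd_of_orthogonal (B := B) (f := φ) (u := u) (w := u) (irreducible_X_sub_C ε)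
      (by rwa [aeval_sub_pow]) (by rwa [aeval_sub_pow]) fun r => ?_
    rw [h.symm, map_mul, Module.End.mul_apply]
    exact aeval_mem_of_invariant
      (h.apply_mem_orthogonal (U := polySpan φ u) fun _ hw => apply_mem_polySpan hw) r
      (fun n hn => (h.symm _ _).trans (hv' n hn)) u (self_mem_polySpan φ u)
  obtain ⟨r, rfl⟩ := hdvd
  rw [mul_comm, map_mul, Module.End.mul_apply, aeval_sub_pow, h0, map_zero]

lemma finrank_polySpan_eq {ε : K} {j : ℕ}
    {u : V} (h0 : ((φ - ε • 1) ^ (j + 1)) u = 0) (h1 : B (((φ - ε • 1) ^ j) u) u ≠ 0) :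
    finrank K (polySpan φ u) = j + 1 := by
  rw [finrank_polySpan (q := X - C ε) (k := j + 1) (by rwa [aeval_sub_pow]), natDegree_pow,
    natDegree_X_sub_C, mul_one]
  intro p hp
  refine pow_dvd_of_orthogonal (B := B) (f := φ) (u := u) (w := u) (irreducible_X_sub_C ε)
      (by rwa [aeval_sub_pow]) (by rwa [aeval_sub_pow]) fun r => ?_
  rw [map_mul, Module.End.mul_apply, hp, map_zero, map_zero, LinearMap.zero_apply]

lemma exists_dual [FiniteDimensional K V] (h : IsometryPair B φ ψ) (l : Dual K V) :
    ∃ w, ∀ u, B u w = l u := by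
  have hinj : Function.Injective B := by
    rw [← LinearMap.ker_eq_bot, LinearMap.ker_eq_bot']
    exact fun u hu => h.nondeg u fun w => by rw [hu, LinearMap.zero_apply]
  obtain ⟨w, hw⟩ := (LinearMap.injective_iff_surjective_of_finrank_eq_finrank
    Subspace.dual_finrank_eq.symm).1 hinj l
  exact ⟨w, fun u => by rw [h.symm, hw]⟩

lemma exists_orthogonal_not [FiniteDimensional K V] (h : IsometryPair B φ ψ) {W : Submodule K V}
    {z : V} (hz : z ∉ W) : ∃ w, (∀ u ∈ W, B u w = 0) ∧ B z w ≠ 0 := by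
  obtain ⟨l, hl, hW⟩ := Submodule.exists_le_ker_of_notMem hz
  obtain ⟨w, hw⟩ := h.exists_dual l
  exact ⟨w, fun u hu => by rw [hw]; exact hW hu, by rwa [hw]⟩

lemma exists_odd_of_eigenvector [FiniteDimensional K V] (h : IsometryPair B φ ψ)
    (h2 : (2 : K) ≠ 0) {ε : K} (hε : ε * ε = 1) {j : ℕ} (hj : Even j) {u : V}
    (hu : φ (((φ - ψ) ^ j) u) = ε • ((φ - ψ) ^ j) u)
    (hu' : ((φ - ψ) ^ j) u ∉ LinearMap.range ((φ - ψ) ^ (j + 1))) :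
    ∃ U : Submodule K V, (∀ u ∈ U, φ u ∈ U) ∧ Odd (finrank K U) ∧
      ∀ u ∈ U, (∀ w ∈ U, B u w = 0) → u = 0 := by
  set z := ((φ - ψ) ^ j) u with hz
  have hψz : ψ z = ε • z := by
    have := congrArg (fun x => ε • ψ x) hu
    simpa [h.inv_apply, smul_smul, hε, eq_comm] using this
  have hNz : (φ - ψ) z = 0 := by simp [hu, hψz]
  obtain ⟨w, hw, hzw⟩ := h.exists_orthogonal_not hu'
  have hNw : ((φ - ψ) ^ (j + 1)) w = 0 := by
    have hadj := adj_pow (T := φ - ψ) (T' := -(φ - ψ)) (B := B)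
      (fun u w => by rw [h.skew, LinearMap.neg_apply, map_neg]) (j + 1)
    have : ((-(φ - ψ)) ^ (j + 1)) w = 0 := h.nondeg _ fun v => by
      rw [h.symm, ← hadj]
      exact hw _ ⟨v, rfl⟩
    rw [neg_pow, Module.End.mul_apply] at this
    rcases neg_one_pow_eq_or (End K V) (j + 1) with h1 | h1 <;> simpa [h1] using this
  have hfac : (φ - ε • 1) * (φ + ε • 1) = φ * (φ - ψ) := by
    rw [mul_sub, h.mul_inv]
    simp only [mul_add, sub_mul, smul_mul_assoc, mul_smul_comm, one_mul, mul_one, smul_sub,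
      smul_smul, hε]
    module
  have hc1 : Commute (φ - ε • 1) (φ + ε • 1) := by
    have h1 : Commute φ (ε • 1 : End K V) := (Commute.one_right φ).smul_right ε
    exact ((Commute.refl φ).add_right h1).sub_left
      ((h1.symm).add_right (Commute.refl _))
  have hc2 : Commute φ (φ - ψ) := (Commute.refl φ).sub_right h.commute
  have hc3 : Commute (φ + ε • 1) (φ - ψ) :=
    hc2.add_left ((Commute.one_left _).smul_left ε)
  have hkill : ∀ v, ((φ - ψ) ^ (j + 1)) v = 0 →
      ((φ - ε • 1) ^ (j + 1)) (((φ + ε • 1) ^ (j + 1)) v) = 0 := by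
    intro v hv
    rw [← Module.End.mul_apply, ← hc1.mul_pow, hfac, hc2.mul_pow, Module.End.mul_apply, hv,
      map_zero]
  have hNu : ((φ - ψ) ^ (j + 1)) u = 0 := by
    rw [pow_succ', Module.End.mul_apply, ← hz, hNz]
  have h2ε : (2 * ε) ≠ 0 := mul_ne_zero h2 (left_ne_zero_of_mul_eq_one hε)
  have hpowz : ∀ (f : End K V) (i : ℕ), f z = ε • z → ((f + ε • 1) ^ i) z = (2 * ε) ^ i • z := by
    intro f i hf
    induction i with
    | zero => simp
    | succ i ih =>
      rw [pow_succ', Module.End.mul_apply, ih, map_smul, pow_succ, mul_smul]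
      congr 1
      simp [hf, two_mul, add_smul]
  set W := LinearMap.ker ((φ - ε • 1) ^ (j + 1)) with hW
  have hN : φ - ψ = (1 + ε • ψ) * (φ - ε • 1) := by
    rw [add_mul, one_mul, smul_mul_assoc, mul_sub ψ, h.inv_mul, mul_smul_comm, mul_one, smul_sub,
      smul_smul, hε]
    module
  have hc4 : Commute (1 + ε • ψ) (φ - ε • 1) :=
    (Commute.one_left _).add_left
      ((h.commute.symm.sub_right ((Commute.one_right ψ).smul_right ε)).smul_left ε)
  have hND : ∀ v ∈ W, ((φ - ψ) ^ j) v = (2 : K) ^ j • ((φ - ε • 1) ^ j) v := by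
    intro v hv
    rw [hN]
    refine pow_apply_of_commute hc4 ?_ hv
    intro y hy
    have hy' : φ y = ε • y := by simpa [sub_eq_zero] using hy
    have : ε • ψ y = y := by rw [← map_smul, ← hy', h.inv_apply]
    simp [this, two_smul]
  set u' := ((φ + ε • 1) ^ (j + 1)) u with hu'def
  set w' := ((φ + ε • 1) ^ (j + 1)) w with hw'def
  have hu'W : u' ∈ W := hkill u hNu
  have hw'W : w' ∈ W := hkill w hNw
  have hB : B (((φ - ε • 1) ^ j) u') w' ≠ 0 := by
    have e1 : ((φ - ψ) ^ j) u' = (2 * ε) ^ (j + 1) • z := by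
      rw [hu'def, ← Module.End.mul_apply, ← (hc3.pow_pow (j + 1) j).eq, Module.End.mul_apply,
        ← hz, hpowz φ _ hu]
    have e2 : B z w' = (2 * ε) ^ (j + 1) * B z w := by
      rw [hw'def, ← adj_pow (T := ψ + ε • 1) (fun u w => by simp [h.adj']), hpowz ψ _ hψz,
        map_smul, LinearMap.smul_apply, smul_eq_mul]
    have e3 : B (((φ - ψ) ^ j) u') w' ≠ 0 := by
      rw [e1, map_smul, LinearMap.smul_apply, e2, smul_eq_mul]
      exact mul_ne_zero (pow_ne_zero _ h2ε) (mul_ne_zero (pow_ne_zero _ h2ε) hzw)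
    intro h0
    rw [hND _ hu'W, map_smul, LinearMap.smul_apply, h0, smul_zero] at e3
    exact e3 rfl
  obtain ⟨v, hv, hvv⟩ := exists_self_ne_zero (B := fun a b => B (((φ - ε • 1) ^ j) a) b) h2 W
    (by simp) (by simp)
    (fun a _ b hb => by
      rw [h.adj_pow_of_ker hε hb, hj.neg_one_pow, one_mul, h.symm]) hu'W hw'W hB
  refine ⟨polySpan φ v, fun _ => apply_mem_polySpan, ?_,
    fun _ => h.eq_zero_of_mem_polySpan hv hvv⟩
  rw [finrank_polySpan_eq hv hvv]
  exact hj.add_one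

lemma exists_odd_of_not_mem_range [FiniteDimensional K V] (h : IsometryPair B φ ψ)
    (h2 : (2 : K) ≠ 0) {j : ℕ} (hj : Even j) {u : V}
    (hu : (φ - ψ) (((φ - ψ) ^ j) u) = 0)
    (hu' : ((φ - ψ) ^ j) u ∉ LinearMap.range ((φ - ψ) ^ (j + 1))) :
    ∃ U : Submodule K V, (∀ u ∈ U, φ u ∈ U) ∧ Odd (finrank K U) ∧
      ∀ u ∈ U, (∀ w ∈ U, B u w = 0) → u = 0 := by
  by_contra H
  have hc : Commute (φ - ψ) φ := ((Commute.refl φ).sub_right h.commute).symm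
  have hN : ∀ v, ((φ - ψ) ^ j) (φ v) = φ (((φ - ψ) ^ j) v) := fun v => by
    rw [← Module.End.mul_apply, (hc.pow_left j).eq, Module.End.mul_apply]
  have hφ : φ (φ (((φ - ψ) ^ j) u)) = ((φ - ψ) ^ j) u := by
    have : φ (((φ - ψ) ^ j) u) = ψ (((φ - ψ) ^ j) u) := by simpa [sub_eq_zero] using hu
    rw [this, h.apply_inv]
  have key : ∀ ε : K, ε * ε = 1 →
      ((φ - ψ) ^ j) (u + ε • φ u) ∈ LinearMap.range ((φ - ψ) ^ (j + 1)) := by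
    intro ε hε
    by_contra hn
    refine H (h.exists_odd_of_eigenvector h2 hε hj ?_ hn)
    rw [map_add, map_smul, hN, map_add, map_smul, hφ, smul_add, smul_smul, hε, one_smul, add_comm]
  have h1 := key 1 (by ring)
  have h3 := key (-1) (by ring)
  have := (LinearMap.range ((φ - ψ) ^ (j + 1))).smul_mem (2 : K)⁻¹ (Submodule.add_mem _ h1 h3)
  rw [← map_add, ← map_smul] at this
  apply hu'
  convert this using 2
  rw [one_smul, neg_one_smul, add_add_add_comm, add_neg_cancel, add_zero, ← two_smul K u, smul_smul,
    inv_mul_cancel₀ h2, one_smul]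

end IsometryPair

section Counting

variable [Field K] [AddCommGroup V] [Module K V]

lemma finrank_map_pow_succ_add [FiniteDimensional K V] (N : End K V) (W : Submodule K V) (j : ℕ) :
    finrank K (W.map (N ^ (j + 1))) + finrank K (W.map (N ^ j) ⊓ LinearMap.ker N : Submodule K V) =
      finrank K (W.map (N ^ j)) := by
  have h := (N.domRestrict (W.map (N ^ j))).finrank_range_add_finrank_ker
  rw [LinearMap.range_domRestrict, LinearMap.ker_domRestrict, ← Submodule.map_comp,
    ← Module.End.mul_eq_comp, ← pow_succ'] at h
  rw [← h, ← Submodule.finrank_map_subtype_eq (W.map (N ^ j)), Submodule.map_comap_subtype]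

lemma anticommute_pow {σ N : End K V} (hN : ∀ v, σ (N v) = -N (σ v)) (j : ℕ) (v : V) :
    σ ((N ^ j) v) = (-1 : K) ^ j • (N ^ j) (σ v) := by
  induction j with
  | zero => simp
  | succ j ih => rw [pow_succ', Module.End.mul_apply, hN, ih, map_smul, pow_succ]; simp

lemma map_pow_inf_ker {σ N : End K V} (hσ : ∀ v, σ (σ v) = v) (hN : ∀ v, σ (N v) = -N (σ v))
    (h2 : (2 : K) ≠ 0) {j : ℕ} (hj : Even j)
    (H : ∀ u, N ((N ^ j) u) = 0 → (N ^ j) u ∈ LinearMap.range (N ^ (j + 1)))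
    {s : K} (hs : s * s = 1) :
    (LinearMap.ker (σ - s • 1)).map (N ^ j) ⊓ LinearMap.ker N =
      (LinearMap.ker (σ - (-s) • 1)).map (N ^ (j + 1)) ⊓ LinearMap.ker N := by
  apply le_antisymm
  · rintro _ ⟨⟨x, hx, rfl⟩, hz⟩
    refine ⟨?_, hz⟩
    have hx' : σ x = s • x := by simpa [sub_eq_zero] using hx
    obtain ⟨v, hv⟩ := H x hz
    refine ⟨(2 : K)⁻¹ • (v - s • σ v), ?_, ?_⟩
    · simp only [SetLike.mem_coe, LinearMap.mem_ker, LinearMap.sub_apply, LinearMap.smul_apply,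
        Module.End.one_apply, map_smul, map_sub, hσ]
      have e : s • s • σ v = σ v := by rw [smul_smul, hs, one_smul]
      linear_combination (norm := module) (-(2 : K)⁻¹) • e
    · have e : (N ^ (j + 1)) (σ v) = -(s • (N ^ j) x) := by
        have h1 := anticommute_pow hN (j + 1) v
        rw [hv, anticommute_pow hN j x, hj.neg_one_pow, hj.add_one.neg_one_pow, hx', map_smul] at h1
        rw [one_smul] at h1
        rw [h1, neg_smul, one_smul, neg_neg]
      rw [map_smul, map_sub, map_smul, e, hv, smul_neg, smul_smul, hs, one_smul, sub_neg_eq_add,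
        ← two_smul K, smul_smul, inv_mul_cancel₀ h2, one_smul]
  · rintro _ ⟨⟨x, hx, rfl⟩, hz⟩
    refine ⟨⟨N x, ?_, by rw [pow_succ, Module.End.mul_apply]⟩, hz⟩
    have hx' : σ x = -(s • x) := by simpa [add_eq_zero_iff_eq_neg] using hx
    simp [hN, hx']

lemma finrank_eigenspaces_eq [FiniteDimensional K V] {σ N : End K V} (hσ : ∀ v, σ (σ v) = v)
    (hN : ∀ v, σ (N v) = -N (σ v)) (h2 : (2 : K) ≠ 0)
    (H : ∀ j, Even j → ∀ u, N ((N ^ j) u) = 0 → (N ^ j) u ∈ LinearMap.range (N ^ (j + 1))) :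
    finrank K (LinearMap.ker (σ - (1 : K) • 1)) = finrank K (LinearMap.ker (σ - (-1 : K) • 1)) := by
  set P := LinearMap.ker (σ - (1 : K) • 1) with hP
  set M := LinearMap.ker (σ - (-1 : K) • 1) with hM
  have hPM : ∀ j, Even j → P.map (N ^ j) ⊓ LinearMap.ker N = M.map (N ^ (j + 1)) ⊓ LinearMap.ker N :=
    fun j hj => map_pow_inf_ker hσ hN h2 hj (H j hj) (by ring)
  have hMP : ∀ j, Even j → M.map (N ^ j) ⊓ LinearMap.ker N = P.map (N ^ (j + 1)) ⊓ LinearMap.ker N :=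
    fun j hj => by
      have := map_pow_inf_ker hσ hN h2 hj (H j hj) (s := -1) (by ring)
      rwa [neg_neg] at this
  have step : ∀ m : ℕ, finrank K P + finrank K (M.map (N ^ (2 * m))) =
      finrank K M + finrank K (P.map (N ^ (2 * m))) := by
    intro m
    induction m with
    | zero =>
      rw [mul_zero, pow_zero, Module.End.one_eq_id, Submodule.map_id, Submodule.map_id, add_comm]
    | succ m ih =>
      have hm : Even (2 * m) := even_two_mul m
      have a1 := finrank_map_pow_succ_add N P (2 * m)
      have a2 := finrank_map_pow_succ_add N P (2 * m + 1)
      have b1 := finrank_map_pow_succ_add N M (2 * m)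
      have b2 := finrank_map_pow_succ_add N M (2 * m + 1)
      rw [hPM _ hm] at a1
      rw [hMP _ hm] at b1
      rw [show 2 * (m + 1) = 2 * m + 1 + 1 by ring]
      lia
  have hker : LinearMap.range (N ^ (2 * finrank K V)) ⊓ LinearMap.ker N = ⊥ := by
    rw [eq_bot_iff]
    rintro _ ⟨⟨v, rfl⟩, hv⟩
    have hv' : v ∈ LinearMap.ker (N ^ (2 * finrank K V + 1)) := by
      rw [LinearMap.mem_ker, pow_succ', Module.End.mul_apply]; exact hv
    rw [Module.End.ker_pow_eq_ker_pow_finrank_of_le (by lia),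
      ← Module.End.ker_pow_eq_ker_pow_finrank_of_le (m := 2 * finrank K V) (by lia)] at hv'
    exact hv'
  have hzero : ∀ W : Submodule K V,
      finrank K (W.map (N ^ (2 * finrank K V + 1))) = finrank K (W.map (N ^ (2 * finrank K V))) := by
    intro W
    rw [← finrank_map_pow_succ_add N W (2 * finrank K V), eq_bot_iff.2 ((inf_le_inf_right _
      (LinearMap.map_le_range)).trans hker.le), finrank_bot, add_zero]
  have hle : ∀ s : K, finrank K ((LinearMap.ker (σ - s • 1)).map (N ^ (2 * finrank K V + 1))) ≤
      finrank K ((LinearMap.ker (σ - (-s) • 1)).map (N ^ (2 * finrank K V))) := by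
    intro s
    apply Submodule.finrank_mono
    rintro _ ⟨x, hx, rfl⟩
    refine ⟨N x, ?_, by rw [pow_succ, Module.End.mul_apply]⟩
    have hx' : σ x = s • x := by simpa [sub_eq_zero] using hx
    simp [hN, hx']
  have h1 := hle 1
  have h3 := hle (-1)
  rw [neg_neg] at h3
  rw [hzero, ← hP, ← hM] at h1 h3
  have := step (finrank K V)
  lia

end Counting

section SplitPair

variable [Field K] [AddCommGroup V] [Module K V]

/-- Orthogonal subspaces `X`, `Y` stable under `φ + ψ` and exchanged by `φ - ψ`: the map that is
`1` on `X` and `-1` on `Y` inverts `φ`. -/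
structure SplitPair (B : LinearMap.BilinForm K V) (φ ψ : End K V) (X Y : Submodule K V) :
    Prop where
  orth : ∀ x ∈ X, ∀ y ∈ Y, B x y = 0
  add_left : ∀ x ∈ X, (φ + ψ) x ∈ X
  add_right : ∀ y ∈ Y, (φ + ψ) y ∈ Y
  sub_left : ∀ x ∈ X, (φ - ψ) x ∈ Y
  sub_right : ∀ y ∈ Y, (φ - ψ) y ∈ X

variable {B : LinearMap.BilinForm K V} {φ ψ : End K V}

namespace SplitPair

lemma swap {X Y : Submodule K V} (h : IsometryPair B φ ψ) (p : SplitPair B φ ψ X Y) :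
    SplitPair B φ ψ Y X where
  orth y hy x hx := (h.symm y x).trans (p.orth x hx y hy)
  add_left := p.add_right
  add_right := p.add_left
  sub_left := p.sub_right
  sub_right := p.sub_left

lemma sup {X Y X' Y' : Submodule K V} (h : IsometryPair B φ ψ) (p : SplitPair B φ ψ X Y)
    (p' : SplitPair B φ ψ X' Y') (ho : ∀ u ∈ X ⊔ Y, ∀ w ∈ X' ⊔ Y', B u w = 0) :
    SplitPair B φ ψ (X ⊔ X') (Y ⊔ Y') where
  orth := by
    intro u hu w hw
    obtain ⟨x, hx, x', hx', rfl⟩ := Submodule.mem_sup.1 hu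
    obtain ⟨y, hy, y', hy', rfl⟩ := Submodule.mem_sup.1 hw
    simp [p.orth x hx y hy, p'.orth x' hx' y' hy',
      ho x (Submodule.mem_sup_left hx) y' (Submodule.mem_sup_right hy'), h.symm x' y,
      ho y (Submodule.mem_sup_right hy) x' (Submodule.mem_sup_left hx')]
  add_left u hu := by
    obtain ⟨x, hx, x', hx', rfl⟩ := Submodule.mem_sup.1 hu
    rw [map_add]
    exact Submodule.add_mem_sup (p.add_left x hx) (p'.add_left x' hx')
  add_right u hu := by
    obtain ⟨x, hx, x', hx', rfl⟩ := Submodule.mem_sup.1 hu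
    rw [map_add]
    exact Submodule.add_mem_sup (p.add_right x hx) (p'.add_right x' hx')
  sub_left u hu := by
    obtain ⟨x, hx, x', hx', rfl⟩ := Submodule.mem_sup.1 hu
    rw [map_add]
    exact Submodule.add_mem_sup (p.sub_left x hx) (p'.sub_left x' hx')
  sub_right u hu := by
    obtain ⟨x, hx, x', hx', rfl⟩ := Submodule.mem_sup.1 hu
    rw [map_add]
    exact Submodule.add_mem_sup (p.sub_right x hx) (p'.sub_right x' hx')

lemma apply_mem {X Y : Submodule K V} (h2 : (2 : K) ≠ 0) (p : SplitPair B φ ψ X Y) :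
    ∀ u ∈ X ⊔ Y, φ u ∈ X ⊔ Y := by
  intro u hu
  obtain ⟨x, hx, y, hy, rfl⟩ := Submodule.mem_sup.1 hu
  have e : φ (x + y) =
      (2 : K)⁻¹ • (((φ + ψ) x + (φ - ψ) y) + ((φ + ψ) y + (φ - ψ) x)) := by
    have : ((φ + ψ) x + (φ - ψ) y) + ((φ + ψ) y + (φ - ψ) x) = (2 : K) • φ (x + y) := by
      simp only [LinearMap.add_apply, LinearMap.sub_apply, map_add]
      module
    rw [this, smul_smul, inv_mul_cancel₀ h2, one_smul]
  rw [e]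
  refine Submodule.smul_mem _ _ (Submodule.add_mem_sup ?_ ?_)
  · exact X.add_mem (p.add_left x hx) (p.sub_right y hy)
  · exact Y.add_mem (p.add_right y hy) (p.sub_left x hx)

lemma map {W : Submodule K V} (hφ : ∀ w ∈ W, φ w ∈ W) (hψ : ∀ w ∈ W, ψ w ∈ W)
    {X Y : Submodule K W} (p : SplitPair (B.restrict W) (φ.restrict hφ) (ψ.restrict hψ) X Y) :
    SplitPair B φ ψ (X.map W.subtype) (Y.map W.subtype) where
  orth := by
    rintro _ ⟨x, hx, rfl⟩ _ ⟨y, hy, rfl⟩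
    exact p.orth x hx y hy
  add_left := by
    rintro _ ⟨x, hx, rfl⟩
    exact ⟨_, p.add_left x hx, rfl⟩
  add_right := by
    rintro _ ⟨x, hx, rfl⟩
    exact ⟨_, p.add_right x hx, rfl⟩
  sub_left := by
    rintro _ ⟨x, hx, rfl⟩
    exact ⟨_, p.sub_left x hx, rfl⟩
  sub_right := by
    rintro _ ⟨x, hx, rfl⟩
    exact ⟨_, p.sub_right x hx, rfl⟩

lemma disjoint {X Y : Submodule K V} (h : IsometryPair B φ ψ) (p : SplitPair B φ ψ X Y)
    (hXY : X ⊔ Y = ⊤) : Disjoint X Y := by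
  rw [Submodule.disjoint_def]
  intro v hx hy
  refine h.nondeg v fun w => ?_
  obtain ⟨a, ha, b, hb, rfl⟩ := Submodule.mem_sup.1 (hXY ▸ Submodule.mem_top : w ∈ X ⊔ Y)
  rw [map_add, p.orth v hx b hb, h.symm, p.orth a ha v hy, add_zero]

end SplitPair

lemma adj_aeval {T : End K V} (hT : ∀ u w, B (T u) w = B u (T w)) (p : K[X]) (u w : V) :
    B (aeval T p u) w = B u (aeval T p w) := by
  induction p using Polynomial.induction_on' with
  | add p q hp hq => simp [hp, hq]
  | monomial n a =>
    simp only [aeval_monomial, ← Algebra.smul_def, LinearMap.smul_apply, map_smul,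
      IsometryPair.adj_pow hT]

namespace IsometryPair

lemma adj_add (h : IsometryPair B φ ψ) (u w : V) : B ((φ + ψ) u) w = B u ((φ + ψ) w) := by
  simp [h.adj, h.adj', add_comm]

lemma sub_sub_apply (h : IsometryPair B φ ψ) (v : V) :
    (φ - ψ) ((φ - ψ) v) = aeval (φ + ψ) (X ^ 2 - C 4 : K[X]) v := by
  rw [map_sub, map_pow, aeval_X, aeval_C, pow_two]
  simp only [LinearMap.sub_apply, map_sub, h.apply_inv, h.inv_apply,
    Module.algebraMap_end_apply, Module.End.mul_apply, LinearMap.add_apply, map_add]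
  module

lemma commute_add_sub (h : IsometryPair B φ ψ) : Commute (φ + ψ) (φ - ψ) :=
  ((Commute.refl φ).sub_right h.commute).add_left (h.commute.symm.sub_right (Commute.refl ψ))

lemma sub_aeval (h : IsometryPair B φ ψ) (p : K[X]) (v : V) :
    (φ - ψ) (aeval (φ + ψ) p v) = aeval (φ + ψ) p ((φ - ψ) v) := by
  have : Commute (φ - ψ) (aeval (φ + ψ) p) := by
    induction p using Polynomial.induction_on' with
    | add p q hp hq => rw [map_add]; exact hp.add_right hq
    | monomial n a =>
      rw [aeval_monomial, ← Algebra.smul_def]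
      exact (h.commute_add_sub.symm.pow_right n).smul_right a
  exact LinearMap.congr_fun this.eq v

lemma splitPair_of_orthogonal (h : IsometryPair B φ ψ) (h2 : (2 : K) ≠ 0) {x y : V}
    (hxy : ∀ v ∈ polySpan (φ + ψ) x, B v y = 0) :
    SplitPair B φ ψ (polySpan (φ + ψ) x ⊔ polySpan (φ + ψ) ((φ - ψ) y))
      (polySpan (φ + ψ) y ⊔ polySpan (φ + ψ) ((φ - ψ) x)) where
  orth := by
    have hself : ∀ (r : K[X]) (v : V), B (aeval (φ + ψ) r v) ((φ - ψ) v) = 0 := by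
      intro r v
      have h1 := h.skew (aeval (φ + ψ) r v) v
      rw [h.sub_aeval, adj_aeval h.adj_add, h.symm] at h1
      exact (mul_eq_zero.1 (by linear_combination h1 :
        2 * B (aeval (φ + ψ) r v) ((φ - ψ) v) = 0)).resolve_left h2
    rintro u hu w hw
    obtain ⟨_, ⟨a, rfl⟩, _, ⟨b, rfl⟩, rfl⟩ := Submodule.mem_sup.1 hu
    obtain ⟨_, ⟨c, rfl⟩, _, ⟨d, rfl⟩, rfl⟩ := Submodule.mem_sup.1 hw
    change B (aeval (φ + ψ) a x + aeval (φ + ψ) b ((φ - ψ) y))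
      (aeval (φ + ψ) c y + aeval (φ + ψ) d ((φ - ψ) x)) = 0
    have e1 : B (aeval (φ + ψ) a x) (aeval (φ + ψ) c y) = 0 := by
      rw [← adj_aeval h.adj_add, ← Module.End.mul_apply, ← map_mul]
      exact hxy _ ⟨_, rfl⟩
    have e2 : B (aeval (φ + ψ) a x) (aeval (φ + ψ) d ((φ - ψ) x)) = 0 := by
      rw [← adj_aeval h.adj_add, ← Module.End.mul_apply, ← map_mul]
      exact hself _ _
    have e3 : B (aeval (φ + ψ) b ((φ - ψ) y)) (aeval (φ + ψ) c y) = 0 := by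
      rw [h.symm, ← adj_aeval h.adj_add, ← Module.End.mul_apply, ← map_mul]
      exact hself _ _
    have e4 : B (aeval (φ + ψ) b ((φ - ψ) y)) (aeval (φ + ψ) d ((φ - ψ) x)) = 0 := by
      rw [adj_aeval h.adj_add, h.skew, h.sub_aeval, h.sub_aeval, h.sub_sub_apply, h.symm,
        ← Module.End.mul_apply, ← Module.End.mul_apply, ← map_mul, ← map_mul, neg_eq_zero]
      exact hxy _ ⟨_, rfl⟩
    simp only [map_add, LinearMap.add_apply, e1, e2, e3, e4, add_zero]
  add_left u hu := by
    obtain ⟨v, hv, w, hw, rfl⟩ := Submodule.mem_sup.1 hu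
    rw [map_add]
    exact Submodule.add_mem_sup (apply_mem_polySpan hv) (apply_mem_polySpan hw)
  add_right u hu := by
    obtain ⟨v, hv, w, hw, rfl⟩ := Submodule.mem_sup.1 hu
    rw [map_add]
    exact Submodule.add_mem_sup (apply_mem_polySpan hv) (apply_mem_polySpan hw)
  sub_left u hu := by
    obtain ⟨_, ⟨a, rfl⟩, _, ⟨b, rfl⟩, rfl⟩ := Submodule.mem_sup.1 hu
    change (φ - ψ) (aeval (φ + ψ) a x + aeval (φ + ψ) b ((φ - ψ) y)) ∈ _
    rw [map_add, h.sub_aeval, h.sub_aeval, h.sub_sub_apply]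
    exact Submodule.add_mem _ (Submodule.mem_sup_right ⟨a, rfl⟩) (Submodule.mem_sup_left
      (aeval_mem_polySpan (aeval_mem_polySpan (self_mem_polySpan _ _) _) _))
  sub_right u hu := by
    obtain ⟨_, ⟨a, rfl⟩, _, ⟨b, rfl⟩, rfl⟩ := Submodule.mem_sup.1 hu
    change (φ - ψ) (aeval (φ + ψ) a y + aeval (φ + ψ) b ((φ - ψ) x)) ∈ _
    rw [map_add, h.sub_aeval, h.sub_aeval, h.sub_sub_apply]
    exact Submodule.add_mem _ (Submodule.mem_sup_right ⟨a, rfl⟩) (Submodule.mem_sup_left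
      (aeval_mem_polySpan (aeval_mem_polySpan (self_mem_polySpan _ _) _) _))

end IsometryPair

end SplitPair

section Indecomposable

variable [Field K] [AddCommGroup V] [Module K V]

/-- No proper nonzero `φ`-invariant subspace is nondegenerate for `B`. -/
def OrthIndecomposable (B : LinearMap.BilinForm K V) (φ : End K V) : Prop :=
  ∀ W : Submodule K V, (∀ w ∈ W, φ w ∈ W) →
    (∀ u ∈ W, (∀ w ∈ W, B u w = 0) → u = 0) → W = ⊥ ∨ W = ⊤

variable {B : LinearMap.BilinForm K V} {φ ψ : End K V}

lemma OrthIndecomposable.eq_top (H : OrthIndecomposable B φ) {W : Submodule K V}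
    (hW : ∀ w ∈ W, φ w ∈ W) (hW' : ∀ u ∈ W, (∀ w ∈ W, B u w = 0) → u = 0) {v : V} (hv : v ∈ W)
    (hv0 : v ≠ 0) : W = ⊤ :=
  (H W hW hW').resolve_left fun e => hv0 ((Submodule.mem_bot K).1 (e ▸ hv))

namespace IsometryPair

lemma pow_finrank_eq_zero [FiniteDimensional K V] (h : IsometryPair B φ ψ)
    (H : OrthIndecomposable B φ) {T : End K V}
    (hT : ∀ u w, B (T u) w = B u (T w)) (hc : Commute T φ) {v : V} (hv : T v = 0)
    (hv0 : v ≠ 0) : T ^ finrank K V = 0 := by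
  set n := finrank K V with hn
  have hn0 : n ≠ 0 := fun e => hv0 ((finrank_zero_iff_forall_zero.1 e) v)
  have htop : LinearMap.ker (T ^ n) = ⊤ := by
    refine H.eq_top (fun w hw => ?_) (fun u hu hu' => ?_) (v := v) ?_ hv0
    · have := LinearMap.congr_fun (hc.pow_left n).eq w
      rw [Module.End.mul_apply, Module.End.mul_apply, LinearMap.mem_ker.1 hw, map_zero] at this
      exact this
    · have hr : u ∈ LinearMap.range (T ^ n) := by
        by_contra hr
        obtain ⟨w, hw, hw'⟩ := h.exists_orthogonal_not hr
        refine hw' (hu' w (LinearMap.mem_ker.2 (h.nondeg _ fun z => ?_)))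
        rw [h.symm, ← adj_pow hT]
        exact hw _ ⟨z, rfl⟩
      obtain ⟨z, rfl⟩ := hr
      have hz : z ∈ LinearMap.ker (T ^ (n + n)) := by
        rwa [LinearMap.mem_ker, pow_add, Module.End.mul_apply]
      rwa [Module.End.ker_pow_eq_ker_pow_finrank_of_le (by lia)] at hz
    · obtain ⟨m, hm⟩ := Nat.exists_eq_succ_of_ne_zero hn0
      rw [LinearMap.mem_ker, hm, pow_succ, Module.End.mul_apply, hv, map_zero]
  exact LinearMap.ker_eq_top.1 htop

end IsometryPair

lemma exists_pow_succ_eq_zero [Nontrivial V] {T : End K V} {n : ℕ} (h : T ^ n = 0) :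
    ∃ j : ℕ, T ^ (j + 1) = 0 ∧ T ^ j ≠ 0 := by
  classical
  have hex : ∃ n : ℕ, T ^ n = 0 := ⟨n, h⟩
  obtain ⟨j, hj⟩ : ∃ j, Nat.find hex = j + 1 := by
    refine Nat.exists_eq_succ_of_ne_zero fun e => ?_
    have := Nat.find_spec hex
    rw [e, pow_zero] at this
    exact one_ne_zero this
  exact ⟨j, hj ▸ Nat.find_spec hex, Nat.find_min hex (by lia)⟩

namespace IsometryPair

lemma exists_apply_self_ne_zero (h : IsometryPair B φ ψ) (h2 : (2 : K) ≠ 0) {T : End K V}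
    (hT : ∀ u w, B (T u) w = B u (T w)) (hT0 : T ≠ 0) : ∃ u, B (T u) u ≠ 0 := by
  obtain ⟨a, ha⟩ : ∃ a, T a ≠ 0 := by
    by_contra! e
    exact hT0 (LinearMap.ext e)
  obtain ⟨b, hb⟩ : ∃ b, B (T a) b ≠ 0 := by
    by_contra! e
    exact ha (h.nondeg _ e)
  obtain ⟨v, -, hv⟩ := exists_self_ne_zero (B := fun u w => B (T u) w) h2 ⊤ (by simp) (by simp)
    (fun u _ w _ => by rw [hT, h.symm]) trivial trivial hb
  exact ⟨v, hv⟩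

lemma commute_aeval_add (h : IsometryPair B φ ψ) (p : K[X]) : Commute (aeval (φ + ψ) p) φ := by
  have hc : Commute (φ + ψ) φ := (Commute.refl φ).add_left h.commute.symm
  induction p using Polynomial.induction_on' with
  | add p q hp hq => rw [map_add]; exact hp.add_left hq
  | monomial n a =>
    rw [aeval_monomial, ← Algebra.smul_def]
    exact (hc.pow_left n).smul_left a

lemma exists_splitPair_of_injective [FiniteDimensional K V] [Nontrivial V]
    (h : IsometryPair B φ ψ) (h2 : (2 : K) ≠ 0) (H : OrthIndecomposable B φ) (hN : ∀ v, (φ - ψ) v = 0 → v = 0) :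
    ∃ X Y, SplitPair B φ ψ X Y ∧ X ⊔ Y = ⊤ := by
  obtain ⟨q, hq, r, hr⟩ := WfDvdMonoid.exists_irreducible_factor
    (minpoly.not_isUnit K (φ + ψ)) (minpoly.ne_zero (Algebra.IsIntegral.isIntegral (φ + ψ)))
  have hr0 : r ≠ 0 := by
    rintro rfl
    exact minpoly.ne_zero (Algebra.IsIntegral.isIntegral (R := K) (φ + ψ)) (by simpa using hr)
  obtain ⟨v, hv, hv0⟩ : ∃ v, aeval (φ + ψ) q v = 0 ∧ v ≠ 0 := by
    by_contra! e
    have : aeval (φ + ψ) r = 0 := LinearMap.ext fun v => e _ (by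
      rw [← Module.End.mul_apply, ← map_mul, ← hr, minpoly.aeval, LinearMap.zero_apply])
    have hd := minpoly.dvd K _ this
    rw [hr] at hd
    obtain ⟨c, hc⟩ := hd
    exact hq.not_isUnit (IsUnit.of_mul_eq_one c (mul_right_cancel₀ hr0 (by
      linear_combination -hc)))
  obtain ⟨k, hk, hk0⟩ := exists_pow_succ_eq_zero
    (h.pow_finrank_eq_zero H (adj_aeval h.adj_add q) (h.commute_aeval_add q) hv hv0)
  obtain ⟨u, hu⟩ := h.exists_apply_self_ne_zero h2 (adj_pow (adj_aeval h.adj_add q) k) hk0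
  rw [← map_pow] at hk hu
  have hself : ∀ p : K[X], (∀ r, B (aeval (φ + ψ) (r * p) u) u = 0) →
      ∀ v, aeval (φ + ψ) p v = 0 := by
    intro p hp v
    obtain ⟨s, rfl⟩ := pow_dvd_of_orthogonal hq (LinearMap.congr_fun hk u) hu hp
    rw [mul_comm, map_mul, Module.End.mul_apply, hk, LinearMap.zero_apply, map_zero]
  have hp := h.splitPair_of_orthogonal h2 (x := u) (y := 0) (by simp)
  refine ⟨_, _, hp, H.eq_top (hp.apply_mem h2) (fun v hv hv' => ?_)
    (Submodule.mem_sup_left (Submodule.mem_sup_left (self_mem_polySpan _ u)))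
    (by rintro rfl; simp at hu)⟩
  obtain ⟨_, hx, _, hy, rfl⟩ := Submodule.mem_sup.1 hv
  rw [map_zero] at hp hx hv'
  have hz : polySpan (φ + ψ) (0 : V) = ⊥ := by
    rw [eq_bot_iff]
    rintro _ ⟨p, rfl⟩
    simp
  rw [hz] at hp hx hy hv'
  rw [sup_bot_eq] at hx hp hv'
  rw [bot_sup_eq] at hy hp hv'
  obtain ⟨a, rfl⟩ := hx
  obtain ⟨b, rfl⟩ := hy
  change aeval (φ + ψ) a u + aeval (φ + ψ) b ((φ - ψ) u) = 0
  change ∀ w ∈ _, B (aeval (φ + ψ) a u + aeval (φ + ψ) b ((φ - ψ) u)) w = 0 at hv'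
  have ha : ∀ v, aeval (φ + ψ) a v = 0 := by
    refine hself a fun r => ?_
    have := hv' (aeval (φ + ψ) r u) (Submodule.mem_sup_left ⟨r, rfl⟩)
    rw [map_add, LinearMap.add_apply, h.symm (aeval (φ + ψ) b ((φ - ψ) u)),
      hp.orth (aeval (φ + ψ) r u) ⟨r, rfl⟩ (aeval (φ + ψ) b ((φ - ψ) u)) ⟨b, rfl⟩, add_zero, ← adj_aeval h.adj_add] at this
    rwa [map_mul]
  have hb : ∀ v, aeval (φ + ψ) ((X ^ 2 - C 4) * b) v = 0 := by
    refine hself _ fun r => ?_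
    have := hv' (aeval (φ + ψ) r ((φ - ψ) u)) (Submodule.mem_sup_right ⟨r, rfl⟩)
    rw [ha, zero_add, ← adj_aeval h.adj_add, ← h.sub_aeval, ← h.sub_aeval, ← neg_eq_iff_eq_neg.2
      (h.skew _ _), neg_eq_zero, h.sub_aeval, h.sub_aeval, h.sub_sub_apply] at this
    rwa [map_mul, map_mul]
  rw [ha, zero_add, ← h.sub_aeval, hN (aeval (φ + ψ) b u), map_zero]
  refine hN _ ?_
  rw [h.sub_sub_apply, ← Module.End.mul_apply, ← map_mul, hb]

end IsometryPair

end Indecomposable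

section Eigenvalue

variable [Field K] [AddCommGroup V] [Module K V]

lemma aeval_apply_of_apply_eq_smul {f : End K V} {c : K} {z : V} (hz : f z = c • z) (p : K[X]) :
    aeval f p z = p.eval c • z := by
  by_cases h0 : z = 0
  · simp [h0]
  · exact Module.End.aeval_apply_of_hasEigenvector
      (Module.End.hasEigenvector_iff.2 ⟨Module.End.mem_eigenspace_iff.2 hz, h0⟩)

variable {B : LinearMap.BilinForm K V} {φ ψ : End K V}

namespace IsometryPair

lemma exists_splitPair_of_even [FiniteDimensional K V] [Nontrivial V] (h : IsometryPair B φ ψ)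
    (h2 : (2 : K) ≠ 0) (H : OrthIndecomposable B φ) {ε : K} (hε : ε * ε = 1) {j : ℕ}
    (hj : Even j) (h0 : (φ - ε • 1) ^ (j + 1) = 0) (h1 : (φ - ε • 1) ^ j ≠ 0) :
    ∃ X Y, SplitPair B φ ψ X Y ∧ X ⊔ Y = ⊤ := by
  obtain ⟨u, hu⟩ := h.exists_apply_self_ne_zero h2 (fun u w => by
    rw [h.adj_pow_of_ker hε (LinearMap.congr_fun h0 w), hj.neg_one_pow, one_mul]) h1
  have hp := h.splitPair_of_orthogonal h2 (x := u) (y := 0) (by simp)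
  refine ⟨_, _, hp, top_le_iff.1 ?_⟩
  rw [← H.eq_top (W := polySpan φ u) (fun _ => apply_mem_polySpan)
    (fun _ hv hv' => h.eq_zero_of_mem_polySpan (LinearMap.congr_fun h0 u) hu hv hv')
    (self_mem_polySpan φ u) (by rintro rfl; simp at hu)]
  exact polySpan_le (hp.apply_mem h2)
    (Submodule.mem_sup_left (Submodule.mem_sup_left (self_mem_polySpan _ u)))

lemma add_sub_eq (h : IsometryPair B φ ψ) {ε : K} (hε : ε * ε = 1) :
    φ + ψ - (2 * ε) • 1 = ψ * (φ - ε • 1) ^ 2 := by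
  refine LinearMap.ext fun v => ?_
  simp only [pow_two, Module.End.mul_apply, LinearMap.sub_apply, LinearMap.add_apply,
    LinearMap.smul_apply, Module.End.one_apply, map_sub, map_smul, h.inv_apply, smul_sub,
    smul_smul, hε]
  module

lemma inv_commute_sub (h : IsometryPair B φ ψ) (ε : K) : Commute ψ (φ - ε • 1) :=
  h.commute.symm.sub_right ((Commute.one_right ψ).smul_right ε)

lemma pow_apply_aeval (h : IsometryPair B φ ψ) {ε : K} (hε : ε * ε = 1) (m i : ℕ) (a : K[X])
    (v : V) :
    ((φ - ε • 1) ^ m) (aeval (φ + ψ) ((X - C (2 * ε)) ^ i * a) v) =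
      (ψ ^ i) (aeval (φ + ψ) a (((φ - ε • 1) ^ (m + 2 * i)) v)) := by
  have hc : Commute (aeval (φ + ψ) a) (φ - ε • 1) :=
    (h.commute_aeval_add a).sub_right ((Commute.one_right _).smul_right ε)
  have hψ := h.inv_commute_sub ε
  have e : (φ - ε • 1) ^ m * aeval (φ + ψ) ((X - C (2 * ε)) ^ i * a) =
      ψ ^ i * (aeval (φ + ψ) a * (φ - ε • 1) ^ (m + 2 * i)) := by
    rw [map_mul, aeval_sub_pow, h.add_sub_eq hε, (hψ.pow_right 2).mul_pow, ← pow_mul,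
      (hc.pow_right (m + 2 * i)).eq, pow_add, mul_assoc, mul_assoc, ← mul_assoc,
      ← (hψ.pow_pow i m).eq, mul_assoc]
  exact LinearMap.congr_fun e v

lemma pow_not_mem_polySpan (h : IsometryPair B φ ψ) {ε : K} (hε : ε * ε = 1) {j : ℕ}
    (hj : Odd j) (h0 : (φ - ε • 1) ^ (j + 1) = 0) {x : V} (hx : ((φ - ε • 1) ^ j) x ≠ 0) :
    ((φ - ε • 1) ^ j) x ∉ polySpan (φ + ψ) x := by
  rintro ⟨r, hr⟩
  change aeval (φ + ψ) r x = _ at hr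
  have hφ : φ (((φ - ε • 1) ^ j) x) = ε • ((φ - ε • 1) ^ j) x := by
    have := LinearMap.congr_fun h0 x
    rw [pow_succ', Module.End.mul_apply] at this
    exact sub_eq_zero.1 this
  have hψ : ψ (((φ - ε • 1) ^ j) x) = ε • ((φ - ε • 1) ^ j) x := by
    have := congrArg (fun v => ε • ψ v) hφ
    simpa [h.inv_apply, smul_smul, hε] using this.symm
  have hψi : ∀ i : ℕ, Function.Injective ⇑(ψ ^ i) := fun i => by
    rw [Module.End.coe_pow]
    exact Function.Injective.iterate (Function.LeftInverse.injective h.apply_inv) i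
  have hdvd : ∀ i, 2 * i ≤ j + 1 → (X - C (2 * ε)) ^ i ∣ r := by
    intro i
    induction i with
    | zero => simp
    | succ i ih =>
      intro hi
      obtain ⟨a, rfl⟩ := ih (by lia)
      rw [pow_succ]
      refine mul_dvd_mul_left _ (dvd_iff_isRoot.2 ?_)
      have e := congrArg (fun v => ((φ - ε • 1) ^ (j - 2 * i)) v) hr
      beta_reduce at e
      rw [h.pow_apply_aeval hε, Nat.sub_add_cancel (by lia),
        aeval_apply_of_apply_eq_smul (c := 2 * ε) (by
          rw [LinearMap.add_apply, hφ, hψ, ← add_smul, two_mul]),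
        ← Module.End.mul_apply, ← pow_add,
        show j - 2 * i + j = (j - 2 * i - 1) + (j + 1) by lia, pow_add, h0, mul_zero,
        LinearMap.zero_apply] at e
      exact (smul_eq_zero.1 (hψi i (e.trans (map_zero _).symm))).resolve_right hx
  obtain ⟨k, rfl⟩ := hj
  obtain ⟨a, rfl⟩ := hdvd (k + 1) (by lia)
  have e := h.pow_apply_aeval hε 0 (k + 1) a x
  rw [show 0 + 2 * (k + 1) = 2 * k + 1 + 1 by lia, h0, pow_zero, Module.End.one_apply, hr,
    LinearMap.zero_apply, map_zero, map_zero] at e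
  exact hx e

lemma eq_zero_of_mem_sup_polySpan [FiniteDimensional K V] (h : IsometryPair B φ ψ)
    (h2 : (2 : K) ≠ 0) {ε : K} (hε : ε * ε = 1) {j : ℕ} (hj : Odd j)
    (h0 : (φ - ε • 1) ^ (j + 1) = 0) {x y : V} (hxy : B (((φ - ε • 1) ^ j) x) y ≠ 0) {v : V}
    (hv : v ∈ polySpan φ x ⊔ polySpan φ y)
    (hv' : ∀ w ∈ polySpan φ x ⊔ polySpan φ y, B v w = 0) : v = 0 := by
  set U := polySpan φ x ⊔ polySpan φ y with hU
  have hUφ : ∀ u ∈ U, φ u ∈ U := by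
    intro u hu
    obtain ⟨a, ha, b, hb, rfl⟩ := Submodule.mem_sup.1 hu
    rw [map_add]
    exact Submodule.add_mem_sup (apply_mem_polySpan ha) (apply_mem_polySpan hb)
  have hvo : v ∈ B.orthogonal U := fun w hw => (h.symm w v).trans (hv' w hw)
  have hxU : x ∈ U := Submodule.mem_sup_left (self_mem_polySpan φ x)
  have hyU : y ∈ U := Submodule.mem_sup_right (self_mem_polySpan φ y)
  have hφ : ∀ z, φ (((φ - ε • 1) ^ j) z) = ε • ((φ - ε • 1) ^ j) z := by
    intro z
    have := LinearMap.congr_fun h0 z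
    rw [pow_succ', Module.End.mul_apply] at this
    exact sub_eq_zero.1 this
  have hskew : ∀ u w, B (((φ - ε • 1) ^ j) u) w = -B u (((φ - ε • 1) ^ j) w) := by
    intro u w
    rw [h.adj_pow_of_ker hε (LinearMap.congr_fun h0 w), hj.neg_one_pow, neg_one_mul]
  have halt : ∀ u, B u (((φ - ε • 1) ^ j) u) = 0 := by
    intro u
    have := hskew u u
    rw [h.symm] at this
    exact (mul_eq_zero.1 (show 2 * B u (((φ - ε • 1) ^ j) u) = 0 by
      linear_combination this)).resolve_left h2
  obtain ⟨_, ⟨p, rfl⟩, _, ⟨q, rfl⟩, rfl⟩ := Submodule.mem_sup.1 hv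
  change aeval φ p x + aeval φ q y ∈ B.orthogonal U at hvo
  change aeval φ p x + aeval φ q y = 0
  have hdvd : ∀ i ≤ j + 1, (X - C ε) ^ i ∣ p ∧ (X - C ε) ^ i ∣ q := by
    intro i
    induction i with
    | zero => simp
    | succ i ih =>
      intro hi
      obtain ⟨⟨a, rfl⟩, b, rfl⟩ := ih (by lia)
      have hmem := aeval_mem_of_invariant (h.apply_mem_orthogonal hUφ) ((X - C ε) ^ (j - i)) hvo
      have hz : ∀ (c : K[X]) (z : V), aeval φ ((X - C ε) ^ (j - i)) (aeval φ ((X - C ε) ^ i * c) z)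
          = c.eval ε • ((φ - ε • 1) ^ j) z := by
        intro c z
        rw [← Module.End.mul_apply, ← map_mul, ← mul_assoc, ← pow_add,
          Nat.sub_add_cancel (by lia), mul_comm, map_mul, aeval_sub_pow, Module.End.mul_apply,
          aeval_apply_of_apply_eq_smul (hφ z)]
      rw [map_add, hz, hz] at hmem
      have ex : B x _ = 0 := hmem x hxU
      have ey : B y _ = 0 := hmem y hyU
      rw [map_add, map_smul, map_smul, halt, smul_zero, zero_add, smul_eq_mul,
        ← neg_eq_iff_eq_neg.2 (hskew _ _)] at ex
      rw [map_add, map_smul, map_smul, halt, smul_zero, add_zero, smul_eq_mul, h.symm] at ey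
      rw [pow_succ]
      exact ⟨mul_dvd_mul_left _ (dvd_iff_isRoot.2 ((mul_eq_zero.1 ey).resolve_right hxy)),
        mul_dvd_mul_left _ (dvd_iff_isRoot.2
          ((mul_eq_zero.1 ex).resolve_right (neg_ne_zero.2 hxy)))⟩
  obtain ⟨⟨a, rfl⟩, b, rfl⟩ := hdvd _ le_rfl
  simp [map_mul, aeval_sub_pow, h0]

lemma exists_splitPair_of_odd [FiniteDimensional K V] (h : IsometryPair B φ ψ)
    (h2 : (2 : K) ≠ 0) (H : OrthIndecomposable B φ) {ε : K} (hε : ε * ε = 1) {j : ℕ}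
    (hj : Odd j) (h0 : (φ - ε • 1) ^ (j + 1) = 0) (h1 : (φ - ε • 1) ^ j ≠ 0) :
    ∃ X Y, SplitPair B φ ψ X Y ∧ X ⊔ Y = ⊤ := by
  obtain ⟨x, hx⟩ : ∃ x, ((φ - ε • 1) ^ j) x ≠ 0 := by
    by_contra! e
    exact h1 (LinearMap.ext e)
  obtain ⟨y, hy, hxy⟩ := h.exists_orthogonal_not (h.pow_not_mem_polySpan hε hj h0 hx)
  have hp := h.splitPair_of_orthogonal h2 hy
  refine ⟨_, _, hp, top_le_iff.1 ?_⟩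
  rw [← H.eq_top (W := polySpan φ x ⊔ polySpan φ y) (fun u hu => ?_)
    (fun _ hv hv' => h.eq_zero_of_mem_sup_polySpan h2 hε hj h0 hxy hv hv')
    (Submodule.mem_sup_left (self_mem_polySpan φ x)) (by rintro rfl; simp at hx)]
  · exact sup_le (polySpan_le (hp.apply_mem h2)
      (Submodule.mem_sup_left (Submodule.mem_sup_left (self_mem_polySpan _ x))))
      (polySpan_le (hp.apply_mem h2)
      (Submodule.mem_sup_right (Submodule.mem_sup_left (self_mem_polySpan _ y))))
  · obtain ⟨a, ha, b, hb, rfl⟩ := Submodule.mem_sup.1 hu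
    rw [map_add]
    exact Submodule.add_mem_sup (apply_mem_polySpan ha) (apply_mem_polySpan hb)

lemma exists_splitPair_of_orthIndecomposable [FiniteDimensional K V] (h : IsometryPair B φ ψ)
    (h2 : (2 : K) ≠ 0) (H : OrthIndecomposable B φ) :
    ∃ X Y, SplitPair B φ ψ X Y ∧ X ⊔ Y = ⊤ := by
  rcases subsingleton_or_nontrivial V with hV | hV
  · exact ⟨⊥, ⊥, ⟨by simp, by simp, by simp, by simp, by simp⟩, Subsingleton.elim _ _⟩
  by_cases hN : ∀ v, (φ - ψ) v = 0 → v = 0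
  · exact h.exists_splitPair_of_injective h2 H hN
  push Not at hN
  obtain ⟨v, hv, hv0⟩ := hN
  obtain ⟨ε, hε, w, hw, hw0⟩ : ∃ ε : K, ε * ε = 1 ∧ ∃ w, (φ - ε • 1) w = 0 ∧ w ≠ 0 := by
    have hφφ : φ (φ v) = v := by
      have := congrArg φ (sub_eq_zero.1 (show φ v - ψ v = 0 from hv))
      rwa [h.apply_inv] at this
    by_cases h1 : φ v = v
    · exact ⟨1, by simp, v, by simp [h1], hv0⟩
    · exact ⟨-1, by simp, φ v - v, by simp [hφφ], sub_ne_zero.2 h1⟩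
  have hadj : ∀ a b, B ((φ + ψ - (2 * ε) • 1) a) b = B a ((φ + ψ - (2 * ε) • 1) b) := by
    intro a b
    simp only [LinearMap.sub_apply, map_sub, h.adj_add, LinearMap.smul_apply, map_smul,
      Module.End.one_apply]
  have hc : Commute (φ + ψ - (2 * ε) • 1) φ :=
    ((Commute.refl φ).add_left h.commute.symm).sub_left ((Commute.one_left φ).smul_left _)
  have hn := h.pow_finrank_eq_zero H hadj hc (v := w) (by
    rw [h.add_sub_eq hε, pow_two, Module.End.mul_apply, Module.End.mul_apply, hw, map_zero,
      map_zero]) hw0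
  rw [h.add_sub_eq hε, ((h.inv_commute_sub ε).pow_right 2).mul_pow, ← pow_mul] at hn
  have hD : (φ - ε • 1) ^ (2 * finrank K V) = 0 := by
    have := congrArg (φ ^ finrank K V * ·) hn
    rwa [← mul_assoc, ← h.commute.mul_pow, h.mul_inv, one_pow, one_mul, mul_zero] at this
  obtain ⟨j, h0, h1⟩ := exists_pow_succ_eq_zero hD
  rcases Nat.even_or_odd j with hj | hj
  · exact h.exists_splitPair_of_even h2 H hε hj h0 h1
  · exact h.exists_splitPair_of_odd h2 H hε hj h0 h1

end IsometryPair

end Eigenvalue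

section ExistsSplitPair

variable [Field K] [AddCommGroup V] [Module K V]
variable {B : LinearMap.BilinForm K V} {φ ψ : End K V}

namespace IsometryPair

lemma restrict (h : IsometryPair B φ ψ) {W : Submodule K V} (hφ : ∀ w ∈ W, φ w ∈ W)
    (hψ : ∀ w ∈ W, ψ w ∈ W) (hW : ∀ u ∈ W, (∀ w ∈ W, B u w = 0) → u = 0) :
    IsometryPair (B.restrict W) (φ.restrict hφ) (ψ.restrict hψ) where
  symm u w := h.symm u w
  nondeg u hu := Subtype.ext (hW u u.2 fun w hw => hu ⟨w, hw⟩)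
  mul_inv := LinearMap.ext fun v => Subtype.ext (h.apply_inv v)
  inv_mul := LinearMap.ext fun v => Subtype.ext (h.inv_apply v)
  adj u w := h.adj u w

lemma isCompl_orthogonal [FiniteDimensional K V] (h : IsometryPair B φ ψ) {W : Submodule K V}
    (hW : ∀ u ∈ W, (∀ w ∈ W, B u w = 0) → u = 0) : IsCompl W (B.orthogonal W) := by
  refine (LinearMap.BilinForm.isCompl_orthogonal_iff_disjoint fun u w e =>
    (h.symm w u).trans e).2 (Submodule.disjoint_def.2 fun u hu hu' => hW u hu fun w hw => ?_)
  exact (h.symm u w).trans (hu' w hw)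

lemma exists_splitPair [FiniteDimensional K V] (h : IsometryPair B φ ψ) (h2 : (2 : K) ≠ 0)
    (W : Submodule K V) (hφ : ∀ w ∈ W, φ w ∈ W)
    (hW : ∀ u ∈ W, (∀ w ∈ W, B u w = 0) → u = 0) :
    ∃ X Y, SplitPair B φ ψ X Y ∧ X ⊔ Y = W := by
  induction hn : finrank K W using Nat.strong_induction_on generalizing W with
  | _ n ih =>
  subst hn
  by_cases hdec : ∃ W' ≤ W, W' ≠ ⊥ ∧ W' ≠ W ∧ (∀ w ∈ W', φ w ∈ W') ∧
    ∀ u ∈ W', (∀ w ∈ W', B u w = 0) → u = 0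
  · obtain ⟨W', hle, hbot, hne, hφ', hW'⟩ := hdec
    obtain ⟨X, Y, p, hXY⟩ := ih _ (Submodule.finrank_lt_finrank_of_lt (lt_of_le_of_ne hle hne)) W'
      hφ' hW' rfl
    have hsup : W' ⊔ W ⊓ B.orthogonal W' = W := by
      rw [inf_comm, ← sup_inf_assoc_of_le _ hle, (h.isCompl_orthogonal hW').sup_eq_top,
        top_inf_eq]
    have hlt : W ⊓ B.orthogonal W' < W := by
      refine lt_of_le_of_ne inf_le_left fun e => hbot ?_
      rw [eq_bot_iff, ← (h.isCompl_orthogonal hW').inf_eq_bot]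
      exact le_inf le_rfl (hle.trans (inf_eq_left.1 e))
    obtain ⟨X', Y', p', hXY'⟩ := ih _ (Submodule.finrank_lt_finrank_of_lt hlt)
      (W ⊓ B.orthogonal W')
      (fun w hw => ⟨hφ w hw.1, h.apply_mem_orthogonal hφ' w hw.2⟩)
      (fun u hu hu' => hW u hu.1 fun w hw => by
        rw [← hsup] at hw
        obtain ⟨a, ha, b, hb, rfl⟩ := Submodule.mem_sup.1 hw
        rw [map_add, hu' b hb, h.symm u a, hu.2 a ha, zero_add]) rfl
    refine ⟨_, _, p.sup h p' ?_, ?_⟩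
    · rw [hXY, hXY']
      exact fun u hu w hw => hw.2 u hu
    · rw [sup_sup_sup_comm, hXY, hXY', hsup]
  · have hψ := h.inv_mem hφ
    obtain ⟨X, Y, p, hXY⟩ := (h.restrict hφ hψ hW).exists_splitPair_of_orthIndecomposable h2
      (fun W₁ hφ₁ hW₁ => by
        by_contra! hne
        refine hdec ⟨W₁.map W.subtype, Submodule.map_subtype_le _ _, ?_, ?_, ?_, ?_⟩
        · exact fun e => hne.1 (Submodule.map_injective_of_injective W.subtype_injective
            (e.trans (Submodule.map_bot _).symm))
        · intro e
          refine hne.2 (Submodule.map_injective_of_injective W.subtype_injective ?_)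
          rw [e, Submodule.map_subtype_top]
        · rintro _ ⟨w, hw, rfl⟩
          exact ⟨_, hφ₁ w hw, rfl⟩
        · rintro _ ⟨u, hu, rfl⟩ hu'
          exact congrArg W.subtype (hW₁ u hu fun w hw => hu' w ⟨w, hw, rfl⟩))
    refine ⟨_, _, p.map hφ hψ, ?_⟩
    rw [← Submodule.map_sup, hXY, Submodule.map_subtype_top]

end IsometryPair

end ExistsSplitPair

section Involutions

variable [Field K] [AddCommGroup V] [Module K V]
variable {B : LinearMap.BilinForm K V} {φ ψ σ τ : End K V}

namespace IsometryPair

lemma finrank_orthogonal [FiniteDimensional K V] (h : IsometryPair B φ ψ) (W : Submodule K V) :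
    finrank K W + finrank K (B.orthogonal W) = finrank K V := by
  have hB : B.Nondegenerate :=
    ⟨h.nondeg, fun u hu => h.nondeg u fun w => (h.symm u w).trans (hu w)⟩
  rw [LinearMap.BilinForm.finrank_orthogonal hB]
  exact Nat.add_sub_cancel' (Submodule.finrank_le W)

lemma mem_orthogonal_ker_sub_one (h : IsometryPair B σ σ) (h2 : (2 : K) ≠ 0) {v : V} :
    v ∈ B.orthogonal (LinearMap.ker (σ - 1)) ↔ σ v = -v := by
  constructor
  · intro hv
    refine eq_neg_of_add_eq_zero_left (h.nondeg _ fun w => ?_)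
    have : B (σ w + w) v = 0 := hv _ (by
      rw [LinearMap.mem_ker, LinearMap.sub_apply, map_add, h.apply_inv, Module.End.one_apply,
        add_comm, sub_self])
    rwa [h.symm, map_add, ← h.adj, ← LinearMap.add_apply, ← map_add]
  · intro hv w hw
    have hw' : σ w = w := sub_eq_zero.1 hw
    have := h.adj w v
    rw [hw', hv, map_neg] at this
    exact (mul_eq_zero.1 (show 2 * B w v = 0 by linear_combination this)).resolve_left h2

lemma finrank_range_sub_one_mul [FiniteDimensional K V] (h : IsometryPair B σ σ)
    (h' : IsometryPair B τ τ) (h2 : (2 : K) ≠ 0) :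
    Even (finrank K (LinearMap.range (σ * τ - 1)) + finrank K (LinearMap.range (σ - 1)) +
      finrank K (LinearMap.range (τ - 1))) := by
  set X := LinearMap.ker (σ - 1) with hX
  set X' := LinearMap.ker (τ - 1) with hX'
  have hsup : LinearMap.ker (σ * τ - 1) = X ⊓ X' ⊔ B.orthogonal X ⊓ B.orthogonal X' := by
    refine le_antisymm (fun v hv => ?_) (sup_le (fun v hv => ?_) (fun v hv => ?_))
    · have hv : σ (τ v) = v := sub_eq_zero.1 hv
      have hv' : τ v = σ v := by rw [← h.apply_inv (τ v), hv]
      have e : v = (2 : K)⁻¹ • (v + σ v) + (2 : K)⁻¹ • (v - σ v) := by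
        rw [← smul_add, add_add_sub_cancel, ← two_smul K v, smul_smul, inv_mul_cancel₀ h2,
          one_smul]
      rw [e]
      refine Submodule.add_mem_sup (Submodule.smul_mem _ _ ⟨?_, ?_⟩)
        (Submodule.smul_mem _ _ ⟨(h.mem_orthogonal_ker_sub_one h2).2 ?_,
          (h'.mem_orthogonal_ker_sub_one h2).2 ?_⟩)
      · exact sub_eq_zero.2 (by rw [map_add, h.apply_inv, Module.End.one_apply, add_comm])
      · exact sub_eq_zero.2 (by
          rw [map_add, ← hv', h'.apply_inv, Module.End.one_apply, add_comm])
      · rw [map_sub, h.apply_inv, neg_sub]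
      · rw [map_sub, ← hv', h'.apply_inv, neg_sub]
    · have e : σ v = v := sub_eq_zero.1 hv.1
      have e' : τ v = v := sub_eq_zero.1 hv.2
      exact sub_eq_zero.2 (by rw [Module.End.mul_apply, e', e, Module.End.one_apply])
    · have e := (h.mem_orthogonal_ker_sub_one h2).1 hv.1
      have e' := (h'.mem_orthogonal_ker_sub_one h2).1 hv.2
      exact sub_eq_zero.2 (by
        rw [Module.End.mul_apply, e', map_neg, e, neg_neg, Module.End.one_apply])
  have hdisj : (X ⊓ X') ⊓ (B.orthogonal X ⊓ B.orthogonal X') = ⊥ := by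
    rw [eq_bot_iff]
    rintro v ⟨⟨hv, -⟩, hv', -⟩
    have e : σ v = v := sub_eq_zero.1 hv
    have e' := (h.mem_orthogonal_ker_sub_one h2).1 hv'
    refine (smul_eq_zero.1 (show (2 : K) • v = 0 from ?_)).resolve_left h2
    rw [two_smul, ← eq_neg_iff_add_eq_zero, ← e', e]
  have horth : B.orthogonal X ⊓ B.orthogonal X' = B.orthogonal (X ⊔ X') := by
    refine le_antisymm ?_ (le_inf (LinearMap.BilinForm.orthogonal_le le_sup_left)
      (LinearMap.BilinForm.orthogonal_le le_sup_right))
    rintro v ⟨hv, hv'⟩ w hw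
    obtain ⟨a, ha, b, hb, rfl⟩ := Submodule.mem_sup.1 hw
    change B (a + b) v = 0
    rw [map_add, LinearMap.add_apply, hv a ha, hv' b hb, add_zero]
  have e1 := Submodule.finrank_sup_add_finrank_inf_eq (X ⊓ X')
    (B.orthogonal X ⊓ B.orthogonal X')
  rw [← hsup, hdisj, finrank_bot, horth] at e1
  have e2 := h.finrank_orthogonal (X ⊔ X')
  have e3 := Submodule.finrank_sup_add_finrank_inf_eq X X'
  have e4 := LinearMap.finrank_range_add_finrank_ker (σ * τ - 1)
  have e5 := LinearMap.finrank_range_add_finrank_ker (σ - 1)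
  have e6 := LinearMap.finrank_range_add_finrank_ker (τ - 1)
  rw [← hX] at e5
  rw [← hX'] at e6
  rw [Nat.even_iff]
  omega

lemma exists_odd_of_mul_involutions [FiniteDimensional K V] (h : IsometryPair B σ σ)
    (h' : IsometryPair B τ τ) (h2 : (2 : K) ≠ 0)
    (hσ : Even (finrank K (LinearMap.range (σ - 1))))
    (hV : finrank K V % 4 = 2) :
    ∃ U : Submodule K V, (∀ u ∈ U, (σ * τ) u ∈ U) ∧ Odd (finrank K U) ∧
      ∀ u ∈ U, (∀ w ∈ U, B u w = 0) → u = 0 := by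
  have hφ : IsometryPair B (σ * τ) (τ * σ) :=
    ⟨h.symm, h.nondeg, by rw [mul_assoc, ← mul_assoc τ, h'.mul_inv, one_mul, h.mul_inv],
      by rw [mul_assoc, ← mul_assoc σ, h.mul_inv, one_mul, h'.mul_inv],
      fun u w => by simp only [Module.End.mul_apply, h.adj, h'.adj]⟩
  by_contra hU
  have heq := finrank_eigenspaces_eq (σ := σ) (N := σ * τ - τ * σ) h.apply_inv
    (fun v => by simp [h.apply_inv]) h2 (fun j hj u hu => by
      by_contra hu'
      exact hU (hφ.exists_odd_of_not_mem_range h2 hj hu hu'))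
  have horth : LinearMap.ker (σ - (-1 : K) • 1) = B.orthogonal (LinearMap.ker (σ - 1)) := by
    ext v
    rw [h.mem_orthogonal_ker_sub_one h2, LinearMap.mem_ker]
    simp [add_eq_zero_iff_eq_neg]
  rw [horth, one_smul] at heq
  have e1 := h.finrank_orthogonal (LinearMap.ker (σ - 1))
  have e2 := LinearMap.finrank_range_add_finrank_ker (σ - 1)
  obtain ⟨k, hk⟩ := hσ
  lia

lemma exists_even_splitPair [FiniteDimensional K V] (h : IsometryPair B φ ψ)
    (h2 : (2 : K) ≠ 0) {U : Submodule K V}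
    (hφ : ∀ u ∈ U, φ u ∈ U) (hodd : Odd (finrank K U))
    (hU : ∀ u ∈ U, (∀ w ∈ U, B u w = 0) → u = 0) :
    ∃ X Y, SplitPair B φ ψ X Y ∧ X ⊔ Y = ⊤ ∧ Even (finrank K Y) := by
  have hc := h.isCompl_orthogonal hU
  obtain ⟨X, Y, p, hXY⟩ := h.exists_splitPair h2 U hφ hU
  obtain ⟨X', Y', p', hXY'⟩ := h.exists_splitPair h2 (B.orthogonal U)
    (h.apply_mem_orthogonal hφ) (fun u hu hu' => h.nondeg u fun w => by
      obtain ⟨a, ha, b, hb, rfl⟩ := Submodule.mem_sup.1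
        (hc.sup_eq_top ▸ Submodule.mem_top : w ∈ U ⊔ B.orthogonal U)
      rw [map_add, hu' b hb, h.symm, hu a ha, zero_add])
  have ho : ∀ u ∈ X ⊔ Y, ∀ w ∈ X' ⊔ Y', B u w = 0 := by
    rw [hXY, hXY']
    exact fun u hu w hw => hw u hu
  have hsum : ∀ Z ≤ U, finrank K (Z ⊔ Y' : Submodule K V) = finrank K Z + finrank K Y' := by
    intro Z hZ
    have hd : Z ⊓ Y' = ⊥ := (hc.disjoint.mono hZ (hXY' ▸ le_sup_right)).eq_bot
    have := Submodule.finrank_sup_add_finrank_inf_eq Z Y'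
    rwa [hd, finrank_bot, add_zero] at this
  have htop : X ⊔ X' ⊔ (Y ⊔ Y') = ⊤ := by
    rw [sup_sup_sup_comm, hXY, hXY', hc.sup_eq_top]
  have hd : X ⊓ Y = ⊥ :=
    (((p.sup h p' ho).disjoint h htop).mono le_sup_left le_sup_left).eq_bot
  have hU' := Submodule.finrank_sup_add_finrank_inf_eq X Y
  rw [hd, hXY, finrank_bot, add_zero] at hU'
  by_cases he : Even (finrank K Y + finrank K Y')
  · refine ⟨_, _, p.sup h p' ho, htop, ?_⟩
    rwa [hsum Y (hXY ▸ le_sup_right)]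
  · refine ⟨_, _, (p.swap h).sup h p' (by rwa [sup_comm Y X]), ?_, ?_⟩
    · rw [sup_sup_sup_comm, sup_comm Y X, hXY, hXY', hc.sup_eq_top]
    · rw [hsum X (hXY ▸ le_sup_left)]
      rw [Nat.even_iff] at he ⊢
      rw [Nat.odd_iff] at hodd
      lia

end IsometryPair

lemma SplitPair.exists_involution (h : IsometryPair B φ ψ) (h2 : (2 : K) ≠ 0)
    {X Y : Submodule K V} (p : SplitPair B φ ψ X Y) (hXY : X ⊔ Y = ⊤) :
    ∃ σ : End K V, IsometryPair B σ σ ∧ σ * φ = ψ * σ ∧ LinearMap.range (σ - 1) = Y := by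
  have hc : IsCompl X Y := ⟨p.disjoint h hXY, codisjoint_iff.2 hXY⟩
  obtain ⟨σ, hσX, hσY⟩ : ∃ σ : End K V, (∀ x ∈ X, σ x = x) ∧ ∀ y ∈ Y, σ y = -y := by
    refine ⟨(2 : K) • X.projection Y hc - 1, fun x hx => ?_, fun y hy => ?_⟩
    · rw [LinearMap.sub_apply, LinearMap.smul_apply,
        Submodule.projection_apply_of_mem_left hc hx, Module.End.one_apply, two_smul,
        add_sub_cancel_right]
    · rw [LinearMap.sub_apply, LinearMap.smul_apply,
        Submodule.projection_apply_of_mem_right hc hy, Module.End.one_apply, smul_zero, zero_sub]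
  have hdec : ∀ v, ∃ x ∈ X, ∃ y ∈ Y, x + y = v := fun v =>
    Submodule.mem_sup.1 (hXY ▸ Submodule.mem_top)
  have hσσ : σ * σ = 1 := by
    ext v
    obtain ⟨x, hx, y, hy, rfl⟩ := hdec v
    simp [hσX x hx, hσY y hy]
  refine ⟨σ, ⟨h.symm, h.nondeg, hσσ, hσσ, fun u w => ?_⟩, ?_, le_antisymm ?_ fun y hy => ?_⟩
  · obtain ⟨x, hx, y, hy, rfl⟩ := hdec u
    obtain ⟨x', hx', y', hy', rfl⟩ := hdec w
    simp [hσX x hx, hσY y hy, hσX x' hx', hσY y' hy', p.orth x hx y' hy', h.symm y x',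
      p.orth x' hx' y hy]
  · ext v
    obtain ⟨x, hx, y, hy, rfl⟩ := hdec v
    have e1 := hσX _ (p.add_left x hx)
    have e2 := hσY _ (p.add_right y hy)
    have e3 := hσY _ (p.sub_left x hx)
    have e4 := hσX _ (p.sub_right y hy)
    simp only [LinearMap.add_apply, LinearMap.sub_apply, map_add, map_sub] at e1 e2 e3 e4
    simp only [Module.End.mul_apply, map_add, hσX x hx, hσY y hy, map_neg]
    refine smul_right_injective V h2 ?_
    beta_reduce
    linear_combination (norm := module) e1 + e2 + e3 + e4
  · rintro _ ⟨v, rfl⟩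
    obtain ⟨x, hx, y, hy, rfl⟩ := hdec v
    rw [LinearMap.sub_apply, map_add, hσX x hx, hσY y hy, Module.End.one_apply,
      add_sub_add_left_eq_sub]
    exact Y.sub_mem (Y.neg_mem hy) hy
  · refine ⟨-((2 : K)⁻¹ • y), ?_⟩
    rw [LinearMap.sub_apply, map_neg, map_smul, hσY y hy, Module.End.one_apply, smul_neg,
      neg_neg, sub_neg_eq_add, ← smul_add, ← two_smul K y, smul_smul, inv_mul_cancel₀ h2,
      one_smul]

end Involutions

section QuadraticForms

variable [Field K] [AddCommGroup V] [Module K V] {Q : QuadraticForm K V}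

lemma InO.isometryPair (hQ : Nondefective Q) {φ : V ≃ₗ[K] V} (hφ : InO Q φ) :
    IsometryPair Q.polarBilin (φ : End K V) (φ.symm : End K V) where
  symm u w := QuadraticMap.polar_comm _ u w
  nondeg := hQ
  mul_inv := by ext v; simp
  inv_mul := by ext v; simp
  adj u w := by
    change QuadraticMap.polar Q (φ u) w = QuadraticMap.polar Q u (φ.symm w)
    have hsymm : ∀ v, Q (φ.symm v) = Q v := fun v => by rw [← hφ, φ.apply_symm_apply]
    rw [QuadraticMap.polar, QuadraticMap.polar, hφ, hsymm, ← hφ (u + φ.symm w), map_add φ,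
      φ.apply_symm_apply]

lemma IsometryPair.inO (h2 : (2 : K) ≠ 0) {φ : V ≃ₗ[K] V} {ψ : End K V}
    (h : IsometryPair Q.polarBilin (φ : End K V) ψ) : InO Q φ := by
  intro v
  have e : QuadraticMap.polar Q (φ v) (φ v) = QuadraticMap.polar Q v v :=
    (h.adj v (φ v)).trans (congrArg (QuadraticMap.polar Q v) (h.inv_apply v))
  rw [QuadraticMap.polar_self, QuadraticMap.polar_self, two_nsmul, two_nsmul] at e
  exact mul_left_cancel₀ h2 (by linear_combination e)

lemma InO.isometryPair_of_mul_self (hQ : Nondefective Q) {σ : V ≃ₗ[K] V} (hσ : InO Q σ)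
    (h : σ * σ = 1) : IsometryPair Q.polarBilin (σ : End K V) (σ : End K V) := by
  have := hσ.isometryPair hQ
  rwa [show σ.symm = σ from inv_eq_of_mul_eq_one_right h] at this

end QuadraticForms

theorem stmt1 [Field K] [AddCommGroup V] [Module K V] [FiniteDimensional K V]
    (Q : QuadraticForm K V) (hQ : Nondefective Q)
    (hchar : ringChar K ≠ 2) (hdim : Module.finrank K V % 4 = 2)
    (φ : V ≃ₗ[K] V) (hφ : InSO Q φ) :
    BireflSO Q φ ↔
      ∃ U : Submodule K V, Invariant φ.toLinearMap U ∧
        Odd (Module.finrank K U) ∧ NondegOn Q U := by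
  have h2 : (2 : K) ≠ 0 := Ring.two_ne_zero hchar
  constructor
  · rintro ⟨σ, τ, hσ, hτ, hσσ, hττ, rfl⟩
    exact (hσ.1.isometryPair_of_mul_self hQ hσσ).exists_odd_of_mul_involutions
      (hτ.1.isometryPair_of_mul_self hQ hττ) h2 hσ.2 hdim
  · rintro ⟨U, hinv, hodd, hU⟩
    have h := hφ.1.isometryPair hQ
    obtain ⟨X, Y, p, hXY, hY⟩ := h.exists_even_splitPair h2 hinv hodd hU
    obtain ⟨σ, hσ, hσφ, rfl⟩ := p.exists_involution h h2 hXY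
    let σ' : V ≃ₗ[K] V := LinearEquiv.ofInvolutive σ hσ.apply_inv
    have hσ' : σ' * σ' = 1 := LinearEquiv.ext hσ.apply_inv
    have hσO : InO Q σ' := hσ.inO (φ := σ') h2
    have hττ : σ' * φ * (σ' * φ) = 1 := by
      refine LinearEquiv.ext fun v => ?_
      have e := LinearMap.congr_fun hσφ (σ (φ v))
      change σ (φ (σ (φ v))) = v
      refine e.trans ?_
      change φ.symm (σ (σ (φ v))) = v
      rw [hσ.apply_inv, φ.symm_apply_apply]
    have hτO : InO Q (σ' * φ) := fun v => (hσO _).trans (hφ.1 v)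
    have hφτ : φ = σ' * (σ' * φ) := by rw [← mul_assoc, hσ', one_mul]
    refine ⟨σ', σ' * φ, ⟨hσO, hY⟩, ⟨hτO, ?_⟩, hσ', hττ, hφτ⟩
    have e := hσ.finrank_range_sub_one_mul (hτO.isometryPair_of_mul_self hQ hττ) h2
    have hφ2 : Even (finrank K (LinearMap.range (σ * ((σ' * φ : V ≃ₗ[K] V) : End K V) - 1))) := by
      have := hφ.2
      rw [hφτ] at this
      exact this
    exact (Nat.even_add.1 e).1 (hφ2.add hY)
end

section
/- Suppose char K = 2 and dim V ≥ 4. Then every element of SO(V,Q) is a product of two involutions of SO(V,Q) if and only if dim V ≡ 0 (mod 4). -/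
open Polynomial Module

variable {K V : Type*}

/-- The rank of an alternating form is even. -/
theorem LinearMap.IsAlt.even_finrank_range [Field K] {D : Type*} [AddCommGroup D] [Module K D]
    [FiniteDimensional K D] (B : D →ₗ[K] D →ₗ[K] K) (hB : B.IsAlt) :
    Even (finrank K (LinearMap.range B)) := by
  induction hn : finrank K D using Nat.strong_induction_on generalizing D with
  | _ n ih =>
  by_cases h0 : B = 0
  · rw [h0, LinearMap.range_zero, finrank_bot]
    exact Even.zero
  obtain ⟨a, ha⟩ : ∃ a, B a ≠ 0 := by
    by_contra! h
    exact h0 (LinearMap.ext h)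
  obtain ⟨b, hb⟩ : ∃ b, B a b ≠ 0 := by
    by_contra! h
    exact ha (LinearMap.ext h)
  have hneg : ∀ x y, B x y = -B y x := fun x y => (hB.neg y x).symm
  have haa : B a a = 0 := hB a
  have hbb : B b b = 0 := hB b
  have hba : B b a = -B a b := hneg b a
  obtain ⟨g, hg⟩ : ∃ g : D →ₗ[K] K × K, ∀ x, g x = (B a x, B b x) :=
    ⟨(B a).prod (B b), fun _ => rfl⟩
  have hsplit : ∀ x, x - ((B a b)⁻¹ * B a x) • b + ((B a b)⁻¹ * B b x) • a ∈ LinearMap.ker g := by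
    intro x
    simp only [hg, LinearMap.mem_ker, map_add, map_sub, map_smul,
      haa, hbb, hba, smul_eq_mul, Prod.mk_eq_zero]
    constructor <;> field_simp <;> ring
  have hgsurj : Function.Surjective g := by
    rintro ⟨p, q⟩
    refine ⟨((B a b)⁻¹ * p) • b - ((B a b)⁻¹ * q) • a, ?_⟩
    simp only [hg, map_sub, map_smul, haa, hbb, hba, smul_eq_mul]
    ext <;> simp <;> field_simp
  have hdim := LinearMap.finrank_range_add_finrank_ker g
  rw [LinearMap.range_eq_top.2 hgsurj, finrank_top, finrank_prod, finrank_self] at hdim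
  obtain ⟨B', hB'⟩ : ∃ B' : LinearMap.ker g →ₗ[K] LinearMap.ker g →ₗ[K] K,
      ∀ x y, B' x y = B x y := ⟨B.domRestrict₁₂ (LinearMap.ker g) (LinearMap.ker g), fun _ _ => rfl⟩
  have hev := ih (finrank K (LinearMap.ker g)) (by omega) B' (fun x => (hB' x x).trans (hB x)) rfl
  have hker : (LinearMap.ker B').map (LinearMap.ker g).subtype = LinearMap.ker B := by
    ext x
    simp only [Submodule.mem_map, LinearMap.mem_ker, Submodule.subtype_apply]
    constructor
    · rintro ⟨y, hy, rfl⟩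
      ext d
      have h1 := LinearMap.congr_fun hy ⟨_, hsplit d⟩
      have hy' := (hg y).symm.trans y.2
      simp only [Prod.mk_eq_zero] at hy'
      simpa [hB', hneg y a, hneg y b, hy'.1, hy'.2] using h1
    · intro hx
      refine ⟨⟨x, ?_⟩, ?_, rfl⟩
      · simp [hg, hneg a x, hneg b x, hx]
      · ext d
        simp [hB', hx]
  have h1 := LinearMap.finrank_range_add_finrank_ker B
  have h2 := LinearMap.finrank_range_add_finrank_ker B'
  rw [← hker, Submodule.finrank_map_subtype_eq] at h1
  rw [Nat.even_iff] at hev ⊢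
  omega

section CharTwo

theorem add_self_of_charTwo (K : Type*) {V : Type*} [Field K] [CharP K 2] [AddCommGroup V]
    [Module K V] (v : V) : v + v = 0 := by
  rw [← two_smul K v, CharTwo.two_eq_zero, zero_smul]

theorem eq_of_add_eq_zero_of_charTwo (K : Type*) {V : Type*} [Field K] [CharP K 2]
    [AddCommGroup V] [Module K V] {v w : V} (h : v + w = 0) : v = w := by
  rw [eq_neg_of_add_eq_zero_left h, neg_eq_iff_add_eq_zero]
  exact add_self_of_charTwo K w

theorem neg_eq_of_charTwo (K : Type*) {V : Type*} [Field K] [CharP K 2]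
    [AddCommGroup V] [Module K V] (v : V) : -v = v :=
  neg_eq_iff_add_eq_zero.2 (add_self_of_charTwo K v)

theorem polar_self_of_charTwo [Field K] [CharP K 2] [AddCommGroup V] [Module K V]
    (Q : QuadraticForm K V) (x : V) : QuadraticMap.polar Q x x = 0 := by
  rw [QuadraticMap.polar_self, CharTwo.two_nsmul]

end CharTwo

section Dickson

variable [Field K] [AddCommGroup V] [Module K V]

theorem Nondefective.nondegenerate {Q : QuadraticForm K V} (hQ : Nondefective Q) :
    LinearMap.BilinForm.Nondegenerate Q.polarBilin :=
  ⟨hQ, fun y hy => hQ y fun w => (QuadraticMap.polar_comm Q y w).trans (hy w)⟩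

theorem isRefl_polarBilin (Q : QuadraticForm K V) : LinearMap.IsRefl Q.polarBilin :=
  fun x y h => (QuadraticMap.polar_comm Q y x).trans h

theorem Nondefective.orthogonal_range_eq_ker {Q : QuadraticForm K V} (hQ : Nondefective Q)
    {s : V →ₗ[K] V}
    (hs : ∀ x y, QuadraticMap.polar Q (s x) y = QuadraticMap.polar Q x (s y)) :
    LinearMap.BilinForm.orthogonal Q.polarBilin (LinearMap.range s) = LinearMap.ker s := by
  ext x
  simp only [LinearMap.BilinForm.mem_orthogonal_iff, LinearMap.mem_range, forall_exists_index,
    forall_apply_eq_imp_iff, QuadraticMap.polarBilin_apply_apply, LinearMap.mem_ker, hs]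
  exact ⟨fun h => hQ _ fun w => (QuadraticMap.polar_comm Q _ _).trans (h w),
    fun h a => by rw [h, QuadraticMap.polar_zero_right]⟩

/-- Additivity of the rank modulo two for self-adjoint maps `s` whose form `polar x (s y)` has
diagonal `Q (s x)`; such are the maps `σ - 1` for `σ` an orthogonal involution. -/
theorem Nondefective.even_finrank_range_add [CharP K 2] [FiniteDimensional K V]
    {Q : QuadraticForm K V} (hQ : Nondefective Q) {s r : V →ₗ[K] V}
    (hs : ∀ x y, QuadraticMap.polar Q (s x) y = QuadraticMap.polar Q x (s y))
    (hr : ∀ x y, QuadraticMap.polar Q (r x) y = QuadraticMap.polar Q x (r y))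
    (hsQ : ∀ x, QuadraticMap.polar Q x (s x) = Q (s x))
    (hrQ : ∀ x, QuadraticMap.polar Q x (r x) = Q (r x)) :
    Even (finrank K (LinearMap.range s) + finrank K (LinearMap.range r) +
      finrank K (LinearMap.range (s + r))) := by
  have hnd := hQ.nondegenerate
  have hrefl := isRefl_polarBilin Q
  set D := LinearMap.ker (s.coprod r) with hD
  have hDmem : ∀ p : D, s p.1.1 = r p.1.2 := fun p =>
    eq_of_add_eq_zero_of_charTwo K (LinearMap.mem_ker.1 p.2)
  obtain ⟨β, hβ⟩ : ∃ β : D →ₗ[K] D →ₗ[K] K,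
      ∀ p q, β p q = QuadraticMap.polar Q (p.1.1 + p.1.2) (s q.1.1) :=
    ⟨Q.polarBilin.compl₁₂ ((LinearMap.fst K V V + LinearMap.snd K V V) ∘ₗ D.subtype)
      (s ∘ₗ LinearMap.fst K V V ∘ₗ D.subtype), fun _ _ => rfl⟩
  have hβalt : β.IsAlt := fun p => by
    rw [hβ, QuadraticMap.polar_add_left, hsQ, hDmem p, hrQ, CharTwo.add_self_eq_zero]
  obtain ⟨h, hh⟩ : ∃ h : (LinearMap.ker s × LinearMap.ker r × LinearMap.ker (s + r)) →ₗ[K] V × V,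
      ∀ a, h a = ((a.2.2 : V) + a.1, (a.2.2 : V) + a.2.1) :=
    ⟨LinearMap.prod
      ((LinearMap.ker s).subtype.coprod (LinearMap.coprod 0 (LinearMap.ker (s + r)).subtype))
      (LinearMap.coprod 0 ((LinearMap.ker r).subtype.coprod (LinearMap.ker (s + r)).subtype)),
      fun a => by simp [add_comm]⟩
  have hinf : LinearMap.BilinForm.orthogonal Q.polarBilin (LinearMap.range s ⊓ LinearMap.range r) ≤
      LinearMap.ker s ⊔ LinearMap.ker r := by
    rw [← LinearMap.BilinForm.orthogonal_orthogonal hnd hrefl (LinearMap.ker s ⊔ LinearMap.ker r)]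
    refine LinearMap.BilinForm.orthogonal_le (le_inf ?_ ?_)
    · rw [← LinearMap.BilinForm.orthogonal_orthogonal hnd hrefl (LinearMap.range s),
        hQ.orthogonal_range_eq_ker hs]
      exact LinearMap.BilinForm.orthogonal_le le_sup_left
    · rw [← LinearMap.BilinForm.orthogonal_orthogonal hnd hrefl (LinearMap.range r),
        hQ.orthogonal_range_eq_ker hr]
      exact LinearMap.BilinForm.orthogonal_le le_sup_right
  have hsup : LinearMap.BilinForm.orthogonal Q.polarBilin
      (LinearMap.range s ⊔ LinearMap.range r) = LinearMap.ker s ⊓ LinearMap.ker r := by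
    apply le_antisymm
    · refine le_inf ?_ ?_
      · rw [← hQ.orthogonal_range_eq_ker hs]
        exact LinearMap.BilinForm.orthogonal_le le_sup_left
      · rw [← hQ.orthogonal_range_eq_ker hr]
        exact LinearMap.BilinForm.orthogonal_le le_sup_right
    · rintro x ⟨hx1, hx2⟩ y hy
      obtain ⟨_, ⟨a, rfl⟩, _, ⟨b, rfl⟩, rfl⟩ := Submodule.mem_sup.1 hy
      rw [SetLike.mem_coe, LinearMap.mem_ker] at hx1 hx2
      change QuadraticMap.polar Q (s a + r b) x = 0
      simp [QuadraticMap.polar_add_left, hs, hr, hx1, hx2]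
  have hrad : (LinearMap.ker β).map D.subtype = LinearMap.range h := by
    ext p
    constructor
    · rintro ⟨q, hq, rfl⟩
      have hmem : q.1.1 + q.1.2 ∈ LinearMap.ker s ⊔ LinearMap.ker r := by
        apply hinf
        rintro _ ⟨⟨a, rfl⟩, ⟨b, hb⟩⟩
        have h1 := LinearMap.congr_fun hq ⟨(a, b), by
          simpa [hD, hb] using add_self_of_charTwo K (s a)⟩
        rw [hβ] at h1
        exact (QuadraticMap.polar_comm Q _ _).trans h1
      obtain ⟨a, ha, b, hb, hab⟩ := Submodule.mem_sup.1 hmem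
      rw [LinearMap.mem_ker] at ha hb
      have hq' := hDmem q
      have hz : q.1.1 + a = q.1.2 + b := by
        apply eq_of_add_eq_zero_of_charTwo K
        rw [add_add_add_comm, hab]
        exact add_self_of_charTwo K _
      refine ⟨(⟨a, ha⟩, ⟨b, hb⟩, ⟨q.1.1 + a, ?_⟩), ?_⟩
      · rw [LinearMap.mem_ker, LinearMap.add_apply, map_add, ha, hz, map_add, hb, hq', add_zero]
        exact add_self_of_charTwo K _
      · rw [hh]
        ext
        · simp [add_assoc, add_self_of_charTwo K a]
        · simp [hz, add_assoc, add_self_of_charTwo K b]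
    · rintro ⟨⟨a, b, z⟩, rfl⟩
      have ha : s a = 0 := a.2
      have hb : r b = 0 := b.2
      have hz : s z + r z = 0 := z.2
      refine ⟨⟨h (a, b, z), ?_⟩, ?_, rfl⟩
      · simp [hD, hh, ha, hb, hz]
      · ext q
        have h1 : (h (a, b, z)).1 + (h (a, b, z)).2 = (a : V) + b := by
          rw [hh]
          change (z : V) + a + (z + b) = a + b
          rw [add_add_add_comm, add_self_of_charTwo K, zero_add]
        have h2 : QuadraticMap.polar Q a (s q.1.1) = 0 := by
          rw [← hs, ha, QuadraticMap.polar_zero_left]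
        have h3 : QuadraticMap.polar Q b (s q.1.1) = 0 := by
          rw [hDmem, ← hr, hb, QuadraticMap.polar_zero_left]
        simp only [hβ, h1, QuadraticMap.polar_add_left, h2, h3, add_zero, LinearMap.zero_apply]
  obtain ⟨j, hj⟩ : ∃ j : (LinearMap.ker s ⊓ LinearMap.ker r : Submodule K V) →ₗ[K]
      (LinearMap.ker s × LinearMap.ker r × LinearMap.ker (s + r)),
      ∀ x, ((j x).1 : V) = x ∧ ((j x).2.1 : V) = x ∧ ((j x).2.2 : V) = x :=
    ⟨(Submodule.inclusion inf_le_left).prod ((Submodule.inclusion inf_le_right).prod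
      (Submodule.inclusion fun x hx => by
        have h1 : s x = 0 := hx.1
        have h2 : r x = 0 := hx.2
        simp [h1, h2])), fun _ => ⟨rfl, rfl, rfl⟩⟩
  have hjinj : Function.Injective j := fun x y hxy => by
    apply Subtype.ext
    rw [← (hj x).1, ← (hj y).1, hxy]
  have hkerh : LinearMap.ker h = LinearMap.range j := by
    ext ⟨a, b, z⟩
    constructor
    · intro hx
      rw [LinearMap.mem_ker, hh, Prod.mk_eq_zero] at hx
      have h1 : (z : V) = a := eq_of_add_eq_zero_of_charTwo K hx.1
      have h2 : (z : V) = b := eq_of_add_eq_zero_of_charTwo K hx.2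
      refine ⟨⟨z, ?_, ?_⟩, ?_⟩
      · rw [h1]
        exact a.2
      · rw [h2]
        exact b.2
      · refine Prod.ext (Subtype.ext ?_) (Prod.ext (Subtype.ext ?_) (Subtype.ext ?_))
        · rw [(hj _).1, h1]
        · rw [(hj _).2.1, h2]
        · rw [(hj _).2.2]
    · rintro ⟨x, hx⟩
      rw [← hx, LinearMap.mem_ker, hh, (hj x).1, (hj x).2.1, (hj x).2.2,
        add_self_of_charTwo K, Prod.mk_zero_zero]
  have e1 := LinearMap.finrank_range_add_finrank_ker (s.coprod r)
  have e2 := LinearMap.finrank_range_add_finrank_ker β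
  have e3 := LinearMap.finrank_range_add_finrank_ker h
  have e4 := LinearMap.finrank_range_add_finrank_ker s
  have e5 := LinearMap.finrank_range_add_finrank_ker r
  have e6 := LinearMap.finrank_range_add_finrank_ker (s + r)
  have e7 := LinearMap.BilinForm.finrank_orthogonal hnd (LinearMap.range s ⊔ LinearMap.range r)
  have e8 := Submodule.finrank_le (LinearMap.range s ⊔ LinearMap.range r)
  have e9 := LinearMap.IsAlt.even_finrank_range β hβalt
  rw [LinearMap.range_coprod, finrank_prod, ← hD] at e1
  rw [← Submodule.finrank_map_subtype_eq D, hrad] at e2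
  rw [hkerh, LinearMap.finrank_range_of_inj hjinj, finrank_prod, finrank_prod] at e3
  rw [hsup] at e7
  rw [Nat.even_iff] at e9 ⊢
  omega

end Dickson

section FixedPointFree

variable [Field K] [AddCommGroup V] [Module K V]

/-- The orthogonal reflection along a nonsingular vector. -/
theorem exists_reflection (Q : QuadraticForm K V) {u : V} (hu : Q u ≠ 0) :
    ∃ t : V →ₗ[K] V, (∀ v, Q (t v) = Q v) ∧
      ∀ v, t v = v - ((Q u)⁻¹ * QuadraticMap.polar Q v u) • u := by
  refine ⟨LinearMap.id - ((Q u)⁻¹ • Q.polarBilin.flip u).smulRight u, fun v => ?_, fun v => rfl⟩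
  change Q (v - ((Q u)⁻¹ * QuadraticMap.polar Q v u) • u) = Q v
  rw [sub_eq_add_neg, QuadraticMap.map_add Q, QuadraticMap.map_neg, QuadraticMap.map_smul,
    QuadraticMap.polar_neg_right, QuadraticMap.polar_smul_right, smul_eq_mul, smul_eq_mul]
  field_simp
  ring

/-- A product of reflections along linearly independent vectors fixes only the vectors orthogonal
to all of them. -/
theorem exists_isometry_fixed_orthogonal (Q : QuadraticForm K V) {ι : Type*} {u : ι → V}
    (hli : LinearIndependent K u) (hu : ∀ i, Q (u i) ≠ 0) (s : Finset ι) :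
    ∃ φ : V →ₗ[K] V, (∀ v, Q (φ v) = Q v) ∧ (∀ v, φ v - v ∈ Submodule.span K (u '' s)) ∧
      ∀ v, φ v = v → ∀ i ∈ s, QuadraticMap.polar Q v (u i) = 0 := by
  classical
  induction s using Finset.induction_on with
  | empty => exact ⟨LinearMap.id, by simp, by simp, by simp⟩
  | insert i s hi ih =>
    obtain ⟨φ, h1, h2, h3⟩ := ih
    obtain ⟨t, ht, ht'⟩ := exists_reflection Q (hu i)
    have hle : Submodule.span K (u '' s) ≤ Submodule.span K (u '' (insert i s : Finset ι)) :=
      Submodule.span_mono (Set.image_mono (by simp))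
    have hmem : u i ∈ Submodule.span K (u '' (insert i s : Finset ι)) :=
      Submodule.subset_span ⟨i, by simp, rfl⟩
    have hnot : u i ∉ Submodule.span K (u '' s) := hli.notMem_span_image (by simpa using hi)
    refine ⟨t ∘ₗ φ, fun v => by simp [ht, h1], fun v => ?_, fun v hv => ?_⟩
    · rw [LinearMap.comp_apply, ht', sub_right_comm]
      exact Submodule.sub_mem _ (hle (h2 v)) (Submodule.smul_mem _ _ hmem)
    · rw [LinearMap.comp_apply, ht'] at hv
      have hc : (Q (u i))⁻¹ * QuadraticMap.polar Q (φ v) (u i) = 0 := by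
        by_contra hne
        apply hnot
        rw [← Submodule.smul_mem_iff _ hne]
        have h4 : ((Q (u i))⁻¹ * QuadraticMap.polar Q (φ v) (u i)) • u i = φ v - v := by
          rw [eq_sub_iff_add_eq, add_comm, ← eq_sub_iff_add_eq, hv]
        rw [h4]
        exact h2 v
      rw [hc, zero_smul, sub_zero] at hv
      rw [hv] at hc
      intro j hj
      rcases Finset.mem_insert.1 hj with rfl | hj
      · exact (mul_eq_zero.1 hc).resolve_left (inv_ne_zero (hu j))
      · exact h3 v hv j hj

theorem Nondefective.span_nonsingular_eq_top [FiniteDimensional K V] {Q : QuadraticForm K V}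
    (hQ : Nondefective Q) (hdim : 3 ≤ finrank K V) :
    Submodule.span K {u | Q u ≠ 0} = ⊤ := by
  rw [eq_top_iff]
  rintro x -
  by_cases hx : Q x = 0
  swap
  · exact Submodule.subset_span hx
  obtain ⟨u, hxu, hu⟩ : ∃ u, QuadraticMap.polar Q x u = 0 ∧ Q u ≠ 0 := by
    by_contra! h
    have hnd := hQ.nondegenerate
    set W := LinearMap.BilinForm.orthogonal Q.polarBilin (Submodule.span K {x}) with hW
    have h0 : ∀ w ∈ W, Q w = 0 := fun w hw => h w (hw x (Submodule.mem_span_singleton_self x))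
    have hle : W ≤ LinearMap.BilinForm.orthogonal Q.polarBilin W := fun w hw y hy => by
      change Q (y + w) - Q y - Q w = 0
      rw [h0 _ hw, h0 _ hy, h0 _ (W.add_mem hy hw), sub_zero, sub_zero]
    rw [hW, LinearMap.BilinForm.orthogonal_orthogonal hnd (isRefl_polarBilin Q), ← hW] at hle
    have h1 := Submodule.finrank_mono hle
    have h2 := LinearMap.BilinForm.finrank_orthogonal hnd (Submodule.span K {x})
    rw [← hW] at h2
    have h3 : finrank K (Submodule.span K {x}) ≤ 1 := by
      simpa using finrank_span_le_card (R := K) ({x} : Set V)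
    omega
  have h1 : x = (x + u) - u := by abel
  rw [h1]
  refine Submodule.sub_mem _ (Submodule.subset_span ?_) (Submodule.subset_span hu)
  change Q (x + u) ≠ 0
  rwa [QuadraticMap.map_add Q, hx, hxu, zero_add, add_zero]

theorem Nondefective.exists_isometry_fixed_eq_zero [FiniteDimensional K V] {Q : QuadraticForm K V}
    (hQ : Nondefective Q) (hdim : 3 ≤ finrank K V) :
    ∃ φ : V ≃ₗ[K] V, InO Q φ ∧ ∀ v, φ v = v → v = 0 := by
  classical
  obtain ⟨b, hb, hspan, hli⟩ := exists_linearIndependent K {u | Q u ≠ 0}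
  rw [hQ.span_nonsingular_eq_top hdim] at hspan
  have : Fintype b := hli.setFinite.fintype
  obtain ⟨φ, h1, -, h3⟩ := exists_isometry_fixed_orthogonal Q hli (fun i => hb i.2) Finset.univ
  have hfix : ∀ v, (∀ w, QuadraticMap.polar Q v w = 0) → v = 0 := hQ
  have hinj : Function.Injective φ := by
    rw [← LinearMap.ker_eq_bot, LinearMap.ker_eq_bot']
    intro v hv
    refine hQ v fun w => ?_
    change Q (v + w) - Q v - Q w = 0
    rw [← h1 (v + w), ← h1 v, ← h1 w, map_add, hv, zero_add, QuadraticMap.map_zero, sub_zero,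
      sub_self]
  refine ⟨LinearEquiv.ofInjectiveEndo φ hinj, h1, fun v hv => hfix v fun w => ?_⟩
  have hw : w ∈ Submodule.span K b := hspan ▸ Submodule.mem_top
  have hle : Submodule.span K b ≤ LinearMap.ker (Q.polarBilin v) :=
    Submodule.span_le.2 fun y hy => h3 v hv ⟨y, hy⟩ (Finset.mem_univ _)
  exact hle hw

theorem Nondefective.even_finrank [CharP K 2] [FiniteDimensional K V] {Q : QuadraticForm K V}
    (hQ : Nondefective Q) : Even (finrank K V) := by
  have h := LinearMap.IsAlt.even_finrank_range Q.polarBilin (polar_self_of_charTwo Q)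
  have h1 := LinearMap.finrank_range_add_finrank_ker Q.polarBilin
  rw [LinearMap.BilinForm.Nondegenerate.ker_eq_bot hQ.nondegenerate, finrank_bot] at h1
  rwa [← h1]

theorem range_sub_id_le_ker [CharP K 2] {σ : V ≃ₗ[K] V} (hσ : σ * σ = 1) :
    LinearMap.range (σ.toLinearMap - LinearMap.id) ≤
      LinearMap.ker (σ.toLinearMap - LinearMap.id) := by
  rintro _ ⟨x, rfl⟩
  have h : σ (σ x) = x := LinearEquiv.congr_fun hσ x
  rw [LinearMap.mem_ker]
  simp only [LinearMap.sub_apply, LinearEquiv.coe_coe, LinearMap.id_apply, map_sub, h]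
  rw [← neg_eq_of_charTwo K (x - σ x), neg_sub]
  exact sub_self _

theorem four_dvd_finrank_of_bireflSO [CharP K 2] [FiniteDimensional K V] {Q : QuadraticForm K V}
    {φ : V ≃ₗ[K] V} (hfix : ∀ v, φ v = v → v = 0) (hφ : BireflSO Q φ) : finrank K V % 4 = 0 := by
  obtain ⟨σ, τ, hσ, hτ, hσ2, hτ2, rfl⟩ := hφ
  have h1 := LinearMap.finrank_range_add_finrank_ker (σ.toLinearMap - LinearMap.id)
  have h2 := LinearMap.finrank_range_add_finrank_ker (τ.toLinearMap - LinearMap.id)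
  have h3 := Submodule.finrank_mono (range_sub_id_le_ker hσ2)
  have h4 := Submodule.finrank_mono (range_sub_id_le_ker hτ2)
  have hdisj : Disjoint (LinearMap.ker (σ.toLinearMap - LinearMap.id))
      (LinearMap.ker (τ.toLinearMap - LinearMap.id)) := by
    rw [Submodule.disjoint_def]
    intro x hx hy
    rw [LinearMap.mem_ker, LinearMap.sub_apply, sub_eq_zero] at hx hy
    apply hfix
    change σ (τ x) = x
    exact (congrArg σ hy).trans hx
  have h5 := Submodule.finrank_add_finrank_le_of_disjoint hdisj
  have h6 := hσ.2
  have h7 := hτ.2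
  rw [Nat.even_iff] at h6 h7
  omega

end FixedPointFree

section Gluing

variable [Field K] [AddCommGroup V] [Module K V]

/-- An involution of the spanning family `v` preserving `Q` and its polar form extends to an
isometry. -/
theorem Nondefective.exists_isometry_of_span_eq_top {Q : QuadraticForm K V} (hQ : Nondefective Q)
    {ι : Type*} {v : ι → V} (hv : Submodule.span K (Set.range v) = ⊤) {e : ι → ι}
    (he : Function.Involutive e) (hQe : ∀ i, Q (v (e i)) = Q (v i))
    (hfe : ∀ i j, QuadraticMap.polar Q (v (e i)) (v (e j)) = QuadraticMap.polar Q (v i) (v j)) :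
    ∃ σ : V →ₗ[K] V, (∀ x, Q (σ x) = Q x) ∧ ∀ i, σ (v i) = v (e i) := by
  set Φ := Finsupp.linearCombination K v with hΦ
  set Ψ := Finsupp.linearCombination K (v ∘ e) with hΨ
  have hΦsurj : LinearMap.range Φ = ⊤ := by rw [hΦ, Finsupp.range_linearCombination, hv]
  have hΨsurj : LinearMap.range Ψ = ⊤ := by
    rw [hΨ, Finsupp.range_linearCombination, he.surjective.range_comp, hv]
  have hpol : ∀ a b, QuadraticMap.polar Q (Ψ a) (Ψ b) = QuadraticMap.polar Q (Φ a) (Φ b) := by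
    have h : Q.polarBilin.compl₁₂ Ψ Ψ = Q.polarBilin.compl₁₂ Φ Φ := by
      ext i j
      simpa [hΦ, hΨ] using hfe i j
    exact fun a b => LinearMap.congr_fun (LinearMap.congr_fun h a) b
  have hQeq : ∀ a, Q (Ψ a) = Q (Φ a) := fun a => by
    induction a using Finsupp.induction_linear with
    | zero => simp
    | add a b ha hb =>
      rw [map_add Φ, map_add Ψ, QuadraticMap.map_add Q, QuadraticMap.map_add Q, ha, hb, hpol]
    | single i c => simp [hΦ, hΨ, QuadraticMap.map_smul, hQe]
  have hker : ∀ a, Φ a = 0 → Ψ a = 0 := fun a ha => hQ _ fun w => by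
    obtain ⟨b, rfl⟩ := LinearMap.range_eq_top.1 hΨsurj w
    exact (hpol a b).trans (by rw [ha, QuadraticMap.polar_zero_left])
  obtain ⟨g, hg⟩ := Φ.exists_rightInverse_of_surjective hΦsurj
  have hg' : ∀ x, Φ (g x) = x := LinearMap.congr_fun hg
  refine ⟨Ψ ∘ₗ g, fun x => by rw [LinearMap.comp_apply, hQeq, hg'], fun i => ?_⟩
  have h := hker (g (v i) - Finsupp.single i 1) (by rw [map_sub, hg']; simp [hΦ])
  rw [map_sub, sub_eq_zero] at h
  rw [LinearMap.comp_apply, h]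
  simp [hΨ]

/-- The isometry `φ` is inverted by an orthogonal involution `σ` with
`ker (σ - 1) = range (σ - 1)` (in characteristic two). -/
def IsReversible (Q : QuadraticForm K V) (φ : V ≃ₗ[K] V) : Prop :=
  ∃ σ : V →ₗ[K] V, (∀ v, Q (σ v) = Q v) ∧ (∀ v, σ (σ v) = v) ∧ (∀ v, σ (φ (σ (φ v))) = v) ∧
    ∀ v, σ v = v → ∃ y, v = y + σ y

/-- Splitting off an invariant nondegenerate subspace on which `φ` is reversible. -/
theorem Nondefective.isReversible_of_span [FiniteDimensional K V] {Q : QuadraticForm K V}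
    (hQ : Nondefective Q) {φ : V ≃ₗ[K] V} (hφ : InO Q φ)
    (ih : ∀ (U : Submodule K V) (ψ : U ≃ₗ[K] U), finrank K U < finrank K V →
      Nondefective (Q.comp U.subtype) → InO (Q.comp U.subtype) ψ →
      IsReversible (Q.comp U.subtype) ψ)
    {ι : Type*} {w : ι → V} {e r : ι → ι} (he : Function.Involutive e)
    (her : ∀ i, e (r (e (r i))) = i) (hr : ∀ i, φ (w i) = w (r i))
    (hQe : ∀ i, Q (w (e i)) = Q (w i))
    (hfe : ∀ i j, QuadraticMap.polar Q (w (e i)) (w (e j)) = QuadraticMap.polar Q (w i) (w j))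
    (hne : ∃ i, w i ≠ 0) (hnd : NondegOn Q (Submodule.span K (Set.range w)))
    (hker : ∀ σ : V →ₗ[K] V, (∀ i, σ (w i) = w (e i)) →
      ∀ v ∈ Submodule.span K (Set.range w), σ v = v → ∃ y, v = y + σ y) :
    IsReversible Q φ := by
  set W := Submodule.span K (Set.range w) with hW
  have hrefl := isRefl_polarBilin Q
  set U := LinearMap.BilinForm.orthogonal Q.polarBilin W with hU
  have hwW : ∀ i, w i ∈ W := fun i => Submodule.subset_span ⟨i, rfl⟩
  have hUmem : ∀ {x}, x ∈ U ↔ ∀ i, QuadraticMap.polar Q (w i) x = 0 := fun {x} => by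
    refine ⟨fun h i => h _ (hwW i), fun h y hy => ?_⟩
    have hle : W ≤ LinearMap.ker (Q.polarBilin.flip x) := by
      rw [hW, Submodule.span_le]
      rintro _ ⟨i, rfl⟩
      exact h i
    exact hle hy
  have hcompl : IsCompl W U := by
    apply LinearMap.BilinForm.isCompl_orthogonal_of_restrict_nondegenerate hrefl
    have h : ∀ x : W, (∀ y : W, QuadraticMap.polar Q (x : V) y = 0) → x = 0 := fun x hx =>
      Subtype.ext (hnd x x.2 fun y hy => hx ⟨y, hy⟩)
    exact ⟨h, fun x hx => h x fun y => (QuadraticMap.polar_comm Q _ _).trans (hx y)⟩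
  have hφU : ∀ x ∈ U, φ x ∈ U := fun x hx => hUmem.2 fun i => by
    have h1 : w i = φ (w (e (r (e i)))) := by rw [hr, ← he (r _), her, he]
    rw [h1]
    change Q (φ _ + φ x) - Q (φ _) - Q (φ x) = 0
    rw [← map_add, hφ, hφ, hφ]
    exact hUmem.1 hx _
  have hsplit : ∀ v, ∃ a ∈ W, ∃ b ∈ U, a + b = v := fun v =>
    Submodule.mem_sup.1 (hcompl.sup_eq_top ▸ Submodule.mem_top)
  have hWU : ∀ a ∈ W, ∀ b ∈ U, QuadraticMap.polar Q a b = 0 := fun a ha b hb => hb a ha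
  have hUnd : Nondefective (Q.comp U.subtype) := fun x hx => Subtype.ext <| hQ _ fun v => by
    obtain ⟨a, ha, b, hb, rfl⟩ := hsplit v
    change QuadraticMap.polar Q x (a + b) = 0
    rw [QuadraticMap.polar_add_right, QuadraticMap.polar_comm, hWU a ha x x.2, zero_add]
    exact hx ⟨b, hb⟩
  have hlt : finrank K U < finrank K V := by
    have h1 := Submodule.finrank_add_eq_of_isCompl hcompl
    obtain ⟨i, hi⟩ := hne
    have h2 : 0 < finrank K W := by
      rw [finrank_pos_iff_exists_ne_zero]
      exact ⟨⟨w i, hwW i⟩, fun h => hi (congrArg Subtype.val h)⟩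
    omega
  obtain ⟨ψ, hψ⟩ : ∃ ψ : U ≃ₗ[K] U, ∀ x, (ψ x : V) = φ x :=
    ⟨LinearEquiv.ofInjectiveEndo (φ.toLinearMap.restrict hφU) fun x y hxy =>
      Subtype.ext (φ.injective (congrArg Subtype.val hxy)), fun _ => rfl⟩
  obtain ⟨σ', h1, h2, h3, h4⟩ := ih U ψ hlt hUnd fun x => by
    change Q (ψ x) = Q x
    rw [hψ, hφ]
  have hspan : Submodule.span K (Set.range (Sum.elim w (Subtype.val : U → V))) = ⊤ := by
    rw [Set.Sum.elim_range, Submodule.span_union, Subtype.range_coe, Submodule.span_eq, ← hW,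
      hcompl.sup_eq_top]
  have h1' : ∀ x, Q (σ' x) = Q x := h1
  have hpolσ' : ∀ x y : U, QuadraticMap.polar Q (σ' x : V) (σ' y) = QuadraticMap.polar Q (x : V) y :=
    fun x y => by
      change Q ((σ' x : V) + σ' y) - Q (σ' x) - Q (σ' y) = Q ((x : V) + y) - Q x - Q y
      rw [← U.coe_add, ← map_add, h1', h1', h1', U.coe_add]
  have hinv : Function.Involutive (Sum.map e σ') := by
    rintro (i | x)
    · simp [he i]
    · simp [h2]
  obtain ⟨σ, hσQ, hσ⟩ := hQ.exists_isometry_of_span_eq_top hspan hinv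
    (by
      rintro (i | x)
      · exact hQe i
      · exact h1' x)
    (by
      rintro (i | x) (j | y)
      · exact hfe i j
      · exact (hWU _ (hwW _) _ (σ' y).2).trans (hWU _ (hwW _) _ y.2).symm
      · refine (QuadraticMap.polar_comm Q _ _).trans (Eq.trans ?_ (QuadraticMap.polar_comm Q _ _))
        exact (hWU _ (hwW _) _ (σ' x).2).trans (hWU _ (hwW _) _ x.2).symm
      · exact hpolσ' x y)
  have hσw : ∀ i, σ (w i) = w (e i) := fun i => hσ (Sum.inl i)
  have hσU : ∀ x : U, σ x = σ' x := fun x => hσ (Sum.inr x)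
  refine ⟨σ, hσQ, ?_, ?_, fun v hv => ?_⟩
  · refine LinearMap.congr_fun (f := σ ∘ₗ σ) (g := LinearMap.id) ?_
    refine LinearMap.ext_on_range hspan ?_
    rintro (i | x)
    · simp [hσw, he i]
    · simp [hσU, h2]
  · refine LinearMap.congr_fun (f := σ ∘ₗ φ.toLinearMap ∘ₗ σ ∘ₗ φ.toLinearMap)
      (g := LinearMap.id) ?_
    refine LinearMap.ext_on_range hspan ?_
    rintro (i | x)
    · simp [hσw, hr, her]
    · simp [hσU, ← hψ, h3]
  · obtain ⟨a, ha, b, hb, rfl⟩ := hsplit v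
    have hσa : σ a ∈ W := by
      have hle : W ≤ W.comap σ := by
        rw [hW, Submodule.span_le]
        rintro _ ⟨i, rfl⟩
        simpa [hσw] using hwW (e i)
      exact hle ha
    have hσb := hσU ⟨b, hb⟩
    have hab : σ a - a = b - σ b := by
      rw [map_add] at hv
      rw [sub_eq_sub_iff_add_eq_add, hv, add_comm]
    have h0 : σ a - a = 0 := Submodule.disjoint_def.1 hcompl.disjoint _ (W.sub_mem hσa ha) <| by
      rw [hab, hσb]
      exact U.sub_mem hb (σ' _).2
    rw [h0] at hab
    obtain ⟨y, hy⟩ := hker σ hσw a ha (sub_eq_zero.1 h0)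
    obtain ⟨z, hz⟩ := h4 ⟨b, hb⟩ (Subtype.ext (hσb.symm.trans (sub_eq_zero.1 hab.symm).symm))
    refine ⟨y + z, ?_⟩
    have hz' : b = z + σ z := by
      rw [hσU]
      exact congrArg Subtype.val hz
    rw [map_add]
    nth_rewrite 1 [hy, hz']
    abel

end Gluing

section Trace

variable [Field K] [AddCommGroup V] [Module K V]

theorem Irreducible.pow_succ_dvd_of_functional {π : K[X]} (hπ : Irreducible π) {n : ℕ}
    (L : K[X] →ₗ[K] K) (hL : ∀ p, L (π ^ (n + 1) * p) = 0) {d : K[X]} (hd : L (π ^ n * d) ≠ 0)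
    {b : K[X]} (hb : ∀ c, L (b * c) = 0) : π ^ (n + 1) ∣ b := by
  classical
  have hg : ∀ c, L (EuclideanDomain.gcd b (π ^ (n + 1)) * c) = 0 := fun c => by
    rw [EuclideanDomain.gcd_eq_gcd_ab, add_mul, map_add, mul_assoc, mul_assoc, hb, hL, add_zero]
  obtain ⟨j, hj, hj'⟩ := (dvd_prime_pow hπ.prime _).1 (EuclideanDomain.gcd_dvd_right b (π ^ (n + 1)))
  rcases Nat.lt_or_ge n j with h | h
  · exact ((pow_dvd_pow π h).trans hj'.symm.dvd).trans (EuclideanDomain.gcd_dvd_left b _)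
  · obtain ⟨c, hc⟩ := hj'.dvd.trans (pow_dvd_pow π h)
    rw [hc, mul_assoc] at hd
    exact absurd (hg _) hd

/-- The map `φ + φ⁻¹`. -/
noncomputable def addInv (φ : V ≃ₗ[K] V) : End K V := φ.toLinearMap + φ.symm.toLinearMap

theorem addInv_apply (φ : V ≃ₗ[K] V) (v : V) : addInv φ v = φ v + φ.symm v := rfl

theorem aeval_addInv_apply_comm (φ : V ≃ₗ[K] V) (p : K[X]) (v : V) :
    aeval (addInv φ) p (φ v) = φ (aeval (addInv φ) p v) := by
  have h : Commute (addInv φ) (φ.toLinearMap : End K V) := by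
    ext v
    simp [addInv_apply]
  have h1 : Commute (aeval (addInv φ) p) (φ.toLinearMap : End K V) := by
    induction p using Polynomial.induction_on' with
    | add p q hp hq => rw [map_add]; exact hp.add_left hq
    | monomial n a =>
      rw [aeval_monomial]
      exact (Algebra.commute_algebraMap_left a _).mul_left (h.pow_left n)
  exact LinearMap.congr_fun h1 v

theorem InO.polar_apply {Q : QuadraticForm K V} {φ : V ≃ₗ[K] V} (hφ : InO Q φ) (x y : V) :
    QuadraticMap.polar Q (φ x) (φ y) = QuadraticMap.polar Q x y := by
  change Q (φ x + φ y) - Q (φ x) - Q (φ y) = Q (x + y) - Q x - Q y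
  rw [← map_add, hφ, hφ, hφ]

theorem InO.polar_symm_apply {Q : QuadraticForm K V} {φ : V ≃ₗ[K] V} (hφ : InO Q φ) (x y : V) :
    QuadraticMap.polar Q (φ.symm x) y = QuadraticMap.polar Q x (φ y) := by
  rw [← hφ.polar_apply, φ.apply_symm_apply]

theorem InO.polar_addInv {Q : QuadraticForm K V} {φ : V ≃ₗ[K] V} (hφ : InO Q φ) (x y : V) :
    QuadraticMap.polar Q (addInv φ x) y = QuadraticMap.polar Q x (addInv φ y) := by
  rw [addInv_apply, addInv_apply, QuadraticMap.polar_add_left, QuadraticMap.polar_add_right,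
    hφ.polar_symm_apply, add_comm, QuadraticMap.polar_comm Q x (φ.symm y), hφ.polar_symm_apply y x,
    QuadraticMap.polar_comm Q y]

theorem polar_aeval {Q : QuadraticForm K V} {s : End K V}
    (hs : ∀ x y, QuadraticMap.polar Q (s x) y = QuadraticMap.polar Q x (s y)) (p : K[X]) (x y : V) :
    QuadraticMap.polar Q (aeval s p x) y = QuadraticMap.polar Q x (aeval s p y) := by
  induction p using Polynomial.induction_on generalizing x y with
  | C a => simp [QuadraticMap.polar_smul_left, QuadraticMap.polar_smul_right]
  | add p q hp hq =>
    simp [QuadraticMap.polar_add_left, QuadraticMap.polar_add_right, hp, hq]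
  | monomial n a h =>
    have hcomm : aeval s (C a * X ^ n) * s = s * aeval s (C a * X ^ n) := by
      have h1 := (Commute.all (C a * X ^ n) X).map (aeval (R := K) s)
      rwa [aeval_X] at h1
    rw [pow_succ, ← mul_assoc, aeval_mul, aeval_X, Module.End.mul_apply, h, hs,
      ← Module.End.mul_apply, hcomm]

theorem InO.polar_aeval_addInv_self [CharP K 2] {Q : QuadraticForm K V} {φ : V ≃ₗ[K] V}
    (hφ : InO Q φ) (p : K[X]) (x : V) :
    QuadraticMap.polar Q (aeval (addInv φ) p x) x = 0 := by
  have hpow : ∀ n x, QuadraticMap.polar Q ((addInv φ ^ n) x) x = 0 := by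
    intro n
    induction n using Nat.strong_induction_on with
    | _ n ih =>
      match n with
      | 0 => exact fun x => polar_self_of_charTwo Q x
      | 1 =>
        intro x
        rw [pow_one, addInv_apply, QuadraticMap.polar_add_left, hφ.polar_symm_apply,
          QuadraticMap.polar_comm Q x, CharTwo.add_self_eq_zero]
      | n + 2 =>
        intro x
        rw [pow_succ', Module.End.mul_apply, hφ.polar_addInv, pow_succ, Module.End.mul_apply]
        exact ih n (by omega) _
  induction p using Polynomial.induction_on' with
  | add p q hp hq => rw [map_add, LinearMap.add_apply, QuadraticMap.polar_add_left, hp, hq, add_zero]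
  | monomial n a =>
    rw [aeval_monomial, Module.End.mul_apply, Module.algebraMap_end_apply,
      QuadraticMap.polar_smul_left, hpow, smul_zero]

theorem InO.zpow {Q : QuadraticForm K V} {φ : V ≃ₗ[K] V} (hφ : InO Q φ) (k : ℤ) :
    InO Q (φ ^ k) := by
  have hinv : InO Q φ⁻¹ := fun v => by
    rw [← hφ]
    exact congrArg Q (φ.apply_symm_apply v)
  have hpow : ∀ (ψ : V ≃ₗ[K] V) (n : ℕ), InO Q ψ → InO Q (ψ ^ n) := fun ψ n hψ => by
    induction n with
    | zero => exact fun v => rfl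
    | succ n ih => exact fun v => by rw [pow_succ, LinearEquiv.mul_apply, ih, hψ]
  cases k with
  | ofNat n => exact hpow φ n hφ
  | negSucc n =>
    rw [zpow_negSucc, ← inv_pow]
    exact hpow _ _ hinv

theorem zpow_add_apply (φ : V ≃ₗ[K] V) (k l : ℤ) (v : V) : (φ ^ (k + l)) v = (φ ^ k) ((φ ^ l) v) := by
  rw [zpow_add, LinearEquiv.mul_apply]

theorem zpow_one_add_apply (φ : V ≃ₗ[K] V) (k : ℤ) (v : V) : φ ((φ ^ k) v) = (φ ^ (k + 1)) v := by
  rw [add_comm, zpow_add_apply, zpow_one]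

theorem symm_zpow_apply (φ : V ≃ₗ[K] V) (k : ℤ) (v : V) :
    φ.symm ((φ ^ k) v) = (φ ^ (k - 1)) v := by
  rw [LinearEquiv.symm_apply_eq, zpow_one_add_apply, sub_add_cancel]

end Trace

section Cyclic

variable [Field K] [AddCommGroup V] [Module K V]

theorem aeval_mem {s : End K V} {W : Submodule K V} (hs : ∀ w ∈ W, s w ∈ W) (p : K[X]) {w : V}
    (hw : w ∈ W) : aeval s p w ∈ W := by
  induction p using Polynomial.induction_on generalizing w with
  | C a => simpa using W.smul_mem a hw
  | add p q hp hq => simpa using W.add_mem (hp hw) (hq hw)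
  | monomial n a h =>
    rw [pow_succ, ← mul_assoc, aeval_mul, aeval_X, Module.End.mul_apply]
    exact h (hs _ hw)

theorem map_aeval_apply {s σ : End K V} {W : Submodule K V} (hs : ∀ w ∈ W, s w ∈ W)
    (hσ : ∀ w ∈ W, σ (s w) = s (σ w)) (p : K[X]) {w : V} (hw : w ∈ W) :
    σ (aeval s p w) = aeval s p (σ w) := by
  induction p using Polynomial.induction_on generalizing w with
  | C a => simp
  | add p q hp hq => simp [hp hw, hq hw]
  | monomial n a h =>
    rw [pow_succ, ← mul_assoc, aeval_mul, aeval_X, Module.End.mul_apply, h (hs _ hw), hσ w hw,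
      Module.End.mul_apply]

theorem addInv_mem_span_zpow {φ : V ≃ₗ[K] V} {x v : V}
    (hv : v ∈ Submodule.span K (Set.range fun k : ℤ => (φ ^ k) x)) :
    addInv φ v ∈ Submodule.span K (Set.range fun k : ℤ => (φ ^ k) x) := by
  induction hv using Submodule.span_induction with
  | mem v hv =>
    obtain ⟨k, rfl⟩ := hv
    dsimp only
    rw [addInv_apply, zpow_one_add_apply, symm_zpow_apply]
    exact Submodule.add_mem _ (Submodule.subset_span ⟨_, rfl⟩) (Submodule.subset_span ⟨_, rfl⟩)
  | zero => simp
  | add v w _ _ hv hw => rw [map_add]; exact Submodule.add_mem _ hv hw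
  | smul c v _ hv => rw [map_smul]; exact Submodule.smul_mem _ _ hv

theorem mem_span_zpow_iff (φ : V ≃ₗ[K] V) (x v : V) :
    v ∈ Submodule.span K (Set.range fun k : ℤ => (φ ^ k) x) ↔
      ∃ a b : K[X], v = aeval (addInv φ) a x + aeval (addInv φ) b (φ x) := by
  constructor
  · have h1 : ∀ v, (∃ a b : K[X], v = aeval (addInv φ) a x + aeval (addInv φ) b (φ x)) →
        ∃ a b : K[X], φ v = aeval (addInv φ) a x + aeval (addInv φ) b (φ x) := by
      rintro _ ⟨a, b, rfl⟩
      refine ⟨-b, a + b * X, ?_⟩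
      rw [map_add, ← aeval_addInv_apply_comm, ← aeval_addInv_apply_comm, map_add, aeval_mul,
        aeval_X, map_neg, LinearMap.add_apply, LinearMap.neg_apply, Module.End.mul_apply,
        addInv_apply, φ.symm_apply_apply, map_add]
      abel
    have h2 : ∀ v, (∃ a b : K[X], v = aeval (addInv φ) a x + aeval (addInv φ) b (φ x)) →
        ∃ a b : K[X], φ.symm v = aeval (addInv φ) a x + aeval (addInv φ) b (φ x) := by
      rintro _ ⟨a, b, rfl⟩
      refine ⟨a * X + b, -a, ?_⟩
      rw [LinearEquiv.symm_apply_eq, map_add, ← aeval_addInv_apply_comm,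
        ← aeval_addInv_apply_comm, map_add, aeval_mul,
        aeval_X, map_neg, LinearMap.add_apply, LinearMap.neg_apply, Module.End.mul_apply,
        addInv_apply, φ.symm_apply_apply, map_add]
      abel
    intro hv
    induction hv using Submodule.span_induction with
    | mem v hv =>
      obtain ⟨k, rfl⟩ := hv
      induction k using Int.induction_on with
      | zero => exact ⟨1, 0, by simp⟩
      | succ k ih =>
        have h := h1 _ ih
        rwa [zpow_one_add_apply] at h
      | pred k ih =>
        have h := h2 _ ih
        rwa [symm_zpow_apply] at h
    | zero => exact ⟨0, 0, by simp⟩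
    | add v w _ _ hv hw =>
      obtain ⟨a, b, rfl⟩ := hv
      obtain ⟨c, d, rfl⟩ := hw
      refine ⟨a + c, b + d, ?_⟩
      rw [map_add, map_add, LinearMap.add_apply, LinearMap.add_apply]
      abel
    | smul c v _ hv =>
      obtain ⟨a, b, rfl⟩ := hv
      exact ⟨c • a, c • b, by simp⟩
  · rintro ⟨a, b, rfl⟩
    exact Submodule.add_mem _
      (aeval_mem (fun _ => addInv_mem_span_zpow) a (Submodule.subset_span ⟨0, by simp⟩))
      (aeval_mem (fun _ => addInv_mem_span_zpow) b (Submodule.subset_span ⟨1, by simp⟩))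

theorem InO.dvd_of_cyclic [CharP K 2] {Q : QuadraticForm K V}
    {φ : V ≃ₗ[K] V} (hφ : InO Q φ) {π : K[X]} (hπ : Irreducible π) {n : ℕ} {x : V} {d : K[X]}
    (hx : aeval (addInv φ) (π ^ (n + 1)) x = 0)
    (hd : QuadraticMap.polar Q (aeval (addInv φ) (π ^ n * d) (φ x)) x ≠ 0) {a b : K[X]}
    (h : ∀ w ∈ Submodule.span K (Set.range fun k : ℤ => (φ ^ k) x),
      QuadraticMap.polar Q (aeval (addInv φ) a x + aeval (addInv φ) b (φ x)) w = 0) :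
    π ^ (n + 1) ∣ a ∧ π ^ (n + 1) ∣ b := by
  have hs := polar_aeval hφ.polar_addInv
  obtain ⟨L, hL⟩ : ∃ L : K[X] →ₗ[K] K,
      ∀ p, L p = QuadraticMap.polar Q (aeval (addInv φ) p (φ x)) x :=
    ⟨Q.polarBilin.flip x ∘ₗ LinearMap.applyₗ (φ x) ∘ₗ (aeval (addInv φ)).toLinearMap,
      fun _ => rfl⟩
  have hL0 : ∀ p, L (π ^ (n + 1) * p) = 0 := fun p => by
    rw [hL, mul_comm, aeval_mul, Module.End.mul_apply, aeval_addInv_apply_comm _ (π ^ (n + 1)), hx,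
      map_zero, map_zero, QuadraticMap.polar_zero_left]
  constructor
  · refine hπ.pow_succ_dvd_of_functional L hL0 (d := d) (by rwa [hL]) fun c => ?_
    have h1 := h (aeval (addInv φ) c (φ x)) ((mem_span_zpow_iff φ x _).2 ⟨0, c, by simp⟩)
    rw [QuadraticMap.polar_add_left, ← hs, ← hs, ← Module.End.mul_apply, ← Module.End.mul_apply,
      ← aeval_mul, ← aeval_mul, hφ.polar_aeval_addInv_self, add_zero, hs,
      QuadraticMap.polar_comm, mul_comm] at h1
    rwa [hL]
  · refine hπ.pow_succ_dvd_of_functional L hL0 (d := d) (by rwa [hL]) fun c => ?_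
    have h1 := h (aeval (addInv φ) c x) ((mem_span_zpow_iff φ x _).2 ⟨c, 0, by simp⟩)
    rw [QuadraticMap.polar_add_left, ← hs, ← hs, ← Module.End.mul_apply, ← Module.End.mul_apply,
      ← aeval_mul, ← aeval_mul, hφ.polar_aeval_addInv_self, zero_add, mul_comm] at h1
    rwa [hL]

theorem Nondefective.isReversible_of_cyclic [CharP K 2] [FiniteDimensional K V]
    {Q : QuadraticForm K V} (hQ : Nondefective Q) {φ : V ≃ₗ[K] V} (hφ : InO Q φ)
    (ih : ∀ (U : Submodule K V) (ψ : U ≃ₗ[K] U), finrank K U < finrank K V →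
      Nondefective (Q.comp U.subtype) → InO (Q.comp U.subtype) ψ →
      IsReversible (Q.comp U.subtype) ψ)
    {π : K[X]} (hπ : Irreducible π) {n : ℕ} {x : V} {d : K[X]}
    (hx : aeval (addInv φ) (π ^ (n + 1)) x = 0)
    (hd : QuadraticMap.polar Q (aeval (addInv φ) (π ^ n * d) (φ x)) x ≠ 0) : IsReversible Q φ := by
  have hdvd : ∀ {p}, π ^ (n + 1) ∣ p → aeval (addInv φ) p x = 0 := by
    rintro _ ⟨c, rfl⟩
    rw [mul_comm, aeval_mul, Module.End.mul_apply, hx, map_zero]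
  refine hQ.isReversible_of_span hφ ih (w := fun k : ℤ => (φ ^ k) x) (e := fun k => 1 - k)
    (r := fun k => k + 1) (fun k => by simp) (fun k => by simp) (zpow_one_add_apply φ · x)
    (fun k => by rw [hφ.zpow, hφ.zpow]) (fun k l => ?_) ⟨0, ?_⟩ ?_ ?_
  · rw [← (hφ.zpow (k + l - 1)).polar_apply, ← zpow_add_apply, ← zpow_add_apply,
      QuadraticMap.polar_comm]
    congr 3 <;> ring
  · rintro h
    have h : x = 0 := h
    rw [h, QuadraticMap.polar_zero_right] at hd
    exact hd rfl
  · intro v hv hvw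
    obtain ⟨a, b, rfl⟩ := (mem_span_zpow_iff φ x v).1 hv
    obtain ⟨ha, hb⟩ := hφ.dvd_of_cyclic hπ hx hd hvw
    rw [aeval_addInv_apply_comm, hdvd ha, hdvd hb, map_zero, add_zero]
  · intro σ hσ v hv hσv
    have hσs : ∀ w ∈ Submodule.span K (Set.range fun k : ℤ => (φ ^ k) x),
        σ (addInv φ w) = addInv φ (σ w) := by
      intro w hw
      induction hw using Submodule.span_induction with
      | mem v hv =>
        obtain ⟨k, rfl⟩ := hv
        simp only [addInv_apply, zpow_one_add_apply, symm_zpow_apply, hσ, map_add]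
        rw [add_comm, sub_add_eq_sub_sub, ← sub_add]
      | zero => simp
      | add v w _ _ hv hw => simp only [map_add, hv, hw]
      | smul c v _ hv => simp only [map_smul, hv]
    have hσp : ∀ (p : K[X]), ∀ w ∈ Submodule.span K (Set.range fun k : ℤ => (φ ^ k) x),
        σ (aeval (addInv φ) p w) = aeval (addInv φ) p (σ w) :=
      fun p w => map_aeval_apply (fun _ => addInv_mem_span_zpow) hσs p
    have h0 : σ x = φ x := by simpa using hσ 0
    have h1 : σ (φ x) = x := by simpa using hσ 1
    have hσab : ∀ a b : K[X], σ (aeval (addInv φ) a x + aeval (addInv φ) b (φ x)) =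
        aeval (addInv φ) b x + aeval (addInv φ) a (φ x) := fun a b => by
      rw [map_add, hσp, hσp, h0, h1, add_comm]
      · exact Submodule.subset_span ⟨1, by simp⟩
      · exact Submodule.subset_span ⟨0, by simp⟩
    obtain ⟨a, b, rfl⟩ := (mem_span_zpow_iff φ x v).1 hv
    rw [hσab] at hσv
    have h2 : aeval (addInv φ) (a - b) x + aeval (addInv φ) (b - a) (φ x) = 0 := by
      rw [map_sub, map_sub, LinearMap.sub_apply, LinearMap.sub_apply, sub_add_sub_comm, ← hσv,
        sub_eq_zero, hσv, add_comm]
    obtain ⟨h3, -⟩ := hφ.dvd_of_cyclic hπ hx hd (a := a - b) (b := b - a) fun w _ => by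
      rw [h2, QuadraticMap.polar_zero_left]
    have h4 := hdvd h3
    rw [map_sub, LinearMap.sub_apply, sub_eq_zero] at h4
    refine ⟨aeval (addInv φ) a x, ?_⟩
    have h5 := hσab a 0
    simp only [map_zero, LinearMap.zero_apply, add_zero, zero_add] at h5
    rw [h5, aeval_addInv_apply_comm, aeval_addInv_apply_comm, h4]

end Cyclic

section Unipotent

variable [Field K] [AddCommGroup V] [Module K V] {Q : QuadraticForm K V} {φ : V ≃ₗ[K] V} {n : ℕ}

/-- The map `φ + 1`. -/
def addOne (φ : V ≃ₗ[K] V) : End K V := φ.toLinearMap + LinearMap.id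

theorem addOne_apply (φ : V ≃ₗ[K] V) (v : V) : addOne φ v = φ v + v := rfl

theorem addOne_pow_apply_comm (φ : V ≃ₗ[K] V) (n : ℕ) (v : V) :
    (addOne φ ^ n) (φ v) = φ ((addOne φ ^ n) v) := by
  have h : Commute (addOne φ) (φ.toLinearMap : End K V) := by
    ext v
    simp [addOne_apply]
  exact LinearMap.congr_fun (h.pow_left n) v

theorem addOne_pow_apply_symm_comm (φ : V ≃ₗ[K] V) (n : ℕ) (v : V) :
    (addOne φ ^ n) (φ.symm v) = φ.symm ((addOne φ ^ n) v) := by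
  rw [LinearEquiv.eq_symm_apply, ← addOne_pow_apply_comm, φ.apply_symm_apply]

theorem InO.polar_addOne (hφ : InO Q φ) (x y : V) :
    QuadraticMap.polar Q (addOne φ x) y = QuadraticMap.polar Q x (addOne φ (φ.symm y)) := by
  rw [addOne_apply, addOne_apply, QuadraticMap.polar_add_left, QuadraticMap.polar_add_right,
    φ.apply_symm_apply, add_comm, QuadraticMap.polar_comm Q x (φ.symm y), hφ.polar_symm_apply,
    QuadraticMap.polar_comm Q (φ x)]

theorem X_pow_dvd_of_bicyclic (hn : addOne φ ^ (n + 1) = 0) {x y : V}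
    (hx : QuadraticMap.polar Q x ((addOne φ ^ n) x) = 0)
    (hy : QuadraticMap.polar Q y ((addOne φ ^ n) y) = 0)
    (hxy : QuadraticMap.polar Q x ((addOne φ ^ n) y) ≠ 0)
    (hyx : QuadraticMap.polar Q y ((addOne φ ^ n) x) ≠ 0) {p q : K[X]}
    (h : ∀ i, QuadraticMap.polar Q x
        ((addOne φ ^ i) (aeval (addOne φ) p x + aeval (addOne φ) q y)) = 0 ∧
      QuadraticMap.polar Q y
        ((addOne φ ^ i) (aeval (addOne φ) p x + aeval (addOne φ) q y)) = 0) :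
    X ^ (n + 1) ∣ p ∧ X ^ (n + 1) ∣ q := by
  have hkill : ∀ (p : K[X]) (z : V),
      (addOne φ ^ n) (aeval (addOne φ) p z) = p.coeff 0 • (addOne φ ^ n) z := fun p z => by
    conv_lhs => rw [← Polynomial.divX_mul_X_add p]
    rw [mul_comm, map_add, aeval_mul, aeval_X, aeval_C, LinearMap.add_apply, map_add,
      Module.algebraMap_end_apply, map_smul, ← Module.End.mul_apply, ← mul_assoc, ← pow_succ, hn,
      zero_mul, LinearMap.zero_apply, zero_add]
  have hdvd : ∀ j ≤ n + 1, X ^ j ∣ p ∧ X ^ j ∣ q := by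
    intro j
    induction j with
    | zero => simp
    | succ j ih =>
      intro hj
      obtain ⟨⟨p', hp⟩, ⟨q', hq⟩⟩ := ih (by omega)
      have h1 : (addOne φ ^ (n - j)) (aeval (addOne φ) p x + aeval (addOne φ) q y) =
          p'.coeff 0 • (addOne φ ^ n) x + q'.coeff 0 • (addOne φ ^ n) y := by
        rw [map_add, hp, hq, aeval_mul, aeval_mul, map_pow, aeval_X, ← Module.End.mul_apply,
          ← Module.End.mul_apply, ← mul_assoc, ← mul_assoc, ← pow_add,
          show n - j + j = n by omega, Module.End.mul_apply, Module.End.mul_apply, hkill, hkill]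
      obtain ⟨h2, h3⟩ := h (n - j)
      rw [h1, QuadraticMap.polar_add_right, QuadraticMap.polar_smul_right,
        QuadraticMap.polar_smul_right, smul_eq_mul, smul_eq_mul] at h2 h3
      rw [hx, mul_zero, zero_add, mul_eq_zero, or_iff_left hxy, ← X_dvd_iff] at h2
      rw [hy, mul_zero, add_zero, mul_eq_zero, or_iff_left hyx, ← X_dvd_iff] at h3
      rw [hp, hq, pow_succ]
      exact ⟨mul_dvd_mul_left _ h3, mul_dvd_mul_left _ h2⟩
  exact hdvd _ le_rfl

theorem InO.polar_pow_pow_eq_zero (hφ : InO Q φ) (hn : addOne φ ^ (n + 1) = 0) {i j : ℕ}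
    (hij : n < i + j) (x y : V) :
    QuadraticMap.polar Q ((addOne φ ^ i) x) ((addOne φ ^ j) y) = 0 := by
  induction i generalizing j y with
  | zero =>
    rw [zero_add] at hij
    rw [pow_eq_zero_of_le hij hn, LinearMap.zero_apply, QuadraticMap.polar_zero_right]
  | succ i ih =>
    rw [pow_succ', Module.End.mul_apply, hφ.polar_addOne, ← addOne_pow_apply_symm_comm,
      ← Module.End.mul_apply, ← pow_succ']
    exact ih (by omega) _

variable [CharP K 2]

theorem addOne_addOne_apply (φ : V ≃ₗ[K] V) (v : V) :
    addOne φ (addOne φ v) = φ (addInv φ v) := by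
  rw [addOne_apply, addOne_apply, addInv_apply, map_add, map_add, φ.apply_symm_apply, add_assoc,
    ← add_assoc (φ v), add_self_of_charTwo K, zero_add]

theorem addOne_pow_two_mul (φ : V ≃ₗ[K] V) (n : ℕ) :
    addOne φ ^ (2 * n) = (φ.toLinearMap : End K V) ^ n * addInv φ ^ n := by
  have h : Commute (φ.toLinearMap : End K V) (addInv φ) := by
    ext v
    simp [addInv_apply]
  rw [pow_mul, ← h.mul_pow]
  congr 1
  ext v
  exact addOne_addOne_apply φ v

theorem InO.polar_addOne_addOne (hφ : InO Q φ) (x y : V) :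
    QuadraticMap.polar Q (addOne φ x) (addOne φ y) = QuadraticMap.polar Q (addInv φ x) y := by
  rw [QuadraticMap.polar_comm, hφ.polar_addOne, ← pow_one (addOne φ), addOne_pow_apply_symm_comm,
    pow_one, addOne_addOne_apply, φ.symm_apply_apply, QuadraticMap.polar_comm]

theorem InO.polar_addOne_pow (hφ : InO Q φ) (n : ℕ) (x y : V) :
    QuadraticMap.polar Q ((addOne φ ^ n) x) ((addOne φ ^ n) y) =
      QuadraticMap.polar Q ((addInv φ ^ n) x) y := by
  induction n generalizing x with
  | zero => rfl
  | succ n ih =>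
    rw [pow_succ', Module.End.mul_apply, Module.End.mul_apply, hφ.polar_addOne_addOne,
      pow_succ, Module.End.mul_apply, ← ih]
    rw [addInv_apply, addInv_apply, map_add, addOne_pow_apply_comm, addOne_pow_apply_symm_comm]

theorem InO.map_addOne (hφ : InO Q φ) (x : V) :
    Q (addOne φ x) = QuadraticMap.polar Q (φ x) x := by
  rw [addOne_apply, QuadraticMap.map_add Q, hφ, CharTwo.add_self_eq_zero, zero_add]

theorem addOne_pow_apply_symm (hn : addOne φ ^ (n + 1) = 0) (x : V) :
    (addOne φ ^ n) (φ.symm x) = (addOne φ ^ n) x := by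
  have h := LinearMap.congr_fun hn (φ.symm x)
  rw [pow_succ', Module.End.mul_apply, addOne_apply, ← addOne_pow_apply_comm,
    φ.apply_symm_apply] at h
  exact (eq_of_add_eq_zero_of_charTwo K h).symm

theorem InO.polar_pow_pow (hφ : InO Q φ) (hn : addOne φ ^ (n + 1) = 0) {i j : ℕ}
    (hij : i + j = n) (x y : V) :
    QuadraticMap.polar Q ((addOne φ ^ i) x) ((addOne φ ^ j) y) =
      QuadraticMap.polar Q x ((addOne φ ^ n) y) := by
  induction i generalizing j y with
  | zero =>
    obtain rfl : j = n := by omega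
    rfl
  | succ i ih =>
    rw [pow_succ', Module.End.mul_apply, hφ.polar_addOne, ← addOne_pow_apply_symm_comm,
      ← Module.End.mul_apply, ← pow_succ', ih (by omega), addOne_pow_apply_symm hn]

theorem InO.map_pow_eq_zero (hφ : InO Q φ) {m : ℕ}
    (hm : ∀ x, QuadraticMap.polar Q ((addInv φ ^ m) (φ x)) x = 0) {l : ℕ} (hl : m < l) (x : V) :
    Q ((addOne φ ^ l) x) = 0 := by
  obtain ⟨k, rfl⟩ := Nat.exists_eq_add_of_lt hl
  rw [show m + k + 1 = 1 + (m + k) by ring, pow_add, pow_one, Module.End.mul_apply, hφ.map_addOne,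
    pow_add, Module.End.mul_apply, ← addOne_pow_apply_comm, hφ.polar_addOne_pow, hm]

theorem InO.polar_pow_comm (hφ : InO Q φ) (hn : addOne φ ^ (n + 1) = 0) (x y : V) :
    QuadraticMap.polar Q x ((addOne φ ^ n) y) = QuadraticMap.polar Q y ((addOne φ ^ n) x) := by
  rw [QuadraticMap.polar_comm, ← hφ.polar_pow_pow hn (add_zero n) y x]
  rfl

theorem InO.polar_self_pow (hφ : InO Q φ) {m : ℕ}
    (hm : ∀ x, QuadraticMap.polar Q ((addInv φ ^ m) (φ x)) x = 0)
    (hn : addOne φ ^ (n + 1) = 0) (hmn : n = 2 * m ∨ n = 2 * m + 1) (x : V) :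
    QuadraticMap.polar Q x ((addOne φ ^ n) x) = 0 := by
  rcases hmn with h | h
  · rw [← hφ.polar_pow_pow hn (i := m) (j := m) (by omega), polar_self_of_charTwo]
  · rw [← hφ.polar_pow_pow hn (i := m) (j := m + 1) (by omega), pow_succ', Module.End.mul_apply,
      addOne_apply, QuadraticMap.polar_add_right, polar_self_of_charTwo, add_zero,
      QuadraticMap.polar_comm, ← addOne_pow_apply_comm, hφ.polar_addOne_pow, hm]

/-- The vectors generating a bicyclic summand. -/
theorem InO.exists_pair (hQ : Nondefective Q) (hφ : InO Q φ) {m : ℕ}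
    (hm : ∀ x, QuadraticMap.polar Q ((addInv φ ^ m) (φ x)) x = 0)
    (hn : addOne φ ^ (n + 1) = 0) (hn' : addOne φ ^ n ≠ 0) (hmn : n = 2 * m ∨ n = 2 * m + 1) :
    ∃ x y, QuadraticMap.polar Q x ((addOne φ ^ n) y) ≠ 0 ∧
      ∀ i, Q ((addOne φ ^ i) x) = Q ((addOne φ ^ i) y) := by
  have hself := hφ.polar_self_pow hm hn hmn
  obtain ⟨x0, y0, h0⟩ : ∃ x y, QuadraticMap.polar Q x ((addOne φ ^ n) y) ≠ 0 := by
    by_contra! h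
    refine hn' (LinearMap.ext fun y => hQ _ fun x => ?_)
    exact (QuadraticMap.polar_comm Q _ _).trans (h x y)
  have hstart : ∃ l, 2 * l < n + 2 ∧ ∃ x y, QuadraticMap.polar Q x ((addOne φ ^ n) y) ≠ 0 ∧
      ∀ i, l ≤ i → Q ((addOne φ ^ i) x) = Q ((addOne φ ^ i) y) := by
    have hbig : ∀ x y : V, ∀ i, m + 1 ≤ i → Q ((addOne φ ^ i) x) = Q ((addOne φ ^ i) y) :=
      fun x y i hi => by rw [hφ.map_pow_eq_zero hm hi, hφ.map_pow_eq_zero hm hi]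
    rcases hmn with h | h
    · have hstep : ∀ x y, QuadraticMap.polar Q x ((addOne φ ^ n) y) ≠ 0 →
          Q ((addOne φ ^ m) y) ≠ 0 → ∃ x y, QuadraticMap.polar Q x ((addOne φ ^ n) y) ≠ 0 ∧
            Q ((addOne φ ^ m) x) = Q ((addOne φ ^ m) y) := by
        intro x y hxy hy
        obtain ⟨c, hc⟩ : ∃ c, c = QuadraticMap.polar Q x ((addOne φ ^ n) y) / Q ((addOne φ ^ m) y) :=
          ⟨_, rfl⟩
        have hc' : c * Q ((addOne φ ^ m) y) = QuadraticMap.polar Q x ((addOne φ ^ n) y) := by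
          rw [hc, div_mul_cancel₀ _ hy]
        have hc0 : c ≠ 0 := hc ▸ div_ne_zero hxy hy
        refine ⟨x, x + c • y, ?_, ?_⟩
        · rw [map_add, map_smul, QuadraticMap.polar_add_right, hself, zero_add,
            QuadraticMap.polar_smul_right, smul_eq_mul]
          exact mul_ne_zero hc0 hxy
        · rw [map_add, map_smul, QuadraticMap.map_add Q, QuadraticMap.map_smul,
            QuadraticMap.polar_smul_right, hφ.polar_pow_pow hn (by omega), ← hc', smul_eq_mul,
            smul_eq_mul, mul_assoc, add_assoc, CharTwo.add_self_eq_zero, add_zero]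
      have hex : ∃ x y, QuadraticMap.polar Q x ((addOne φ ^ n) y) ≠ 0 ∧
            Q ((addOne φ ^ m) x) = Q ((addOne φ ^ m) y) := by
        by_cases hy : Q ((addOne φ ^ m) y0) = 0
        · by_cases hx : Q ((addOne φ ^ m) x0) = 0
          · exact ⟨x0, y0, h0, hx.trans hy.symm⟩
          · exact hstep y0 x0 (by rwa [hφ.polar_pow_comm hn]) hx
        · exact hstep x0 y0 h0 hy
      obtain ⟨x, y, hxy, hQxy⟩ := hex
      refine ⟨m, by omega, x, y, hxy, fun i hi => ?_⟩
      rcases hi.eq_or_lt with rfl | hi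
      · exact hQxy
      · exact hbig x y i hi
    · exact ⟨m + 1, by omega, x0, y0, h0, hbig x0 y0⟩
  obtain ⟨l, hl, hstart⟩ := hstart
  induction l with
  | zero =>
    obtain ⟨x, y, hxy, hQxy⟩ := hstart
    exact ⟨x, y, hxy, fun i => hQxy i i.zero_le⟩
  | succ l ih =>
    obtain ⟨x, y, hxy, hQxy⟩ := hstart
    refine ih (by omega) ?_
    obtain ⟨k, hk⟩ : ∃ k, n = 2 * l + k := ⟨n - 2 * l, by omega⟩
    obtain ⟨c, hc⟩ : ∃ c, c * QuadraticMap.polar Q x ((addOne φ ^ n) y) =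
        Q ((addOne φ ^ l) x) + Q ((addOne φ ^ l) y) :=
      ⟨_, div_mul_cancel₀ _ hxy⟩
    have hQc : ∀ i, l ≤ i → Q ((addOne φ ^ i) (x + c • (addOne φ ^ k) y)) =
        Q ((addOne φ ^ i) x) +
          c * QuadraticMap.polar Q ((addOne φ ^ i) x) ((addOne φ ^ (i + k)) y) := fun i hi => by
      rw [map_add, map_smul, ← Module.End.mul_apply, ← pow_add, QuadraticMap.map_add Q,
        QuadraticMap.map_smul, hφ.map_pow_eq_zero hm (show m < i + k by omega), smul_zero, add_zero,
        QuadraticMap.polar_smul_right, smul_eq_mul]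
    refine ⟨x + c • (addOne φ ^ k) y, y, ?_, fun i hi => ?_⟩
    · have h1 := hφ.polar_pow_pow_eq_zero hn (show n < k + n by omega) y y
      rwa [QuadraticMap.polar_add_left, QuadraticMap.polar_smul_left, h1, smul_zero, add_zero]
    · rw [hQc i hi]
      rcases hi.eq_or_lt with rfl | hi
      · rw [hφ.polar_pow_pow hn (by omega), hc, ← add_assoc, CharTwo.add_self_eq_zero, zero_add]
      · rw [hφ.polar_pow_pow_eq_zero hn (by omega), mul_zero, add_zero, hQxy i hi]

theorem InO.polar_iterate_eq (hφ : InO Q φ) {x y : V}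
    (hxy : ∀ i, Q ((addOne φ ^ i) x) = Q ((addOne φ ^ i) y)) (k : ℤ) :
    QuadraticMap.polar Q ((φ ^ k) x) x = QuadraticMap.polar Q ((φ ^ k) y) y := by
  have hrec : ∀ (i : ℕ) (w : V), QuadraticMap.polar Q ((φ ^ (i + 2)) w) w =
      QuadraticMap.polar Q ((φ ^ (i + 1)) (addOne φ w)) (addOne φ w) -
        QuadraticMap.polar Q ((φ ^ i) w) w := fun i w => by
    have h1 : (φ ^ (i + 1)) (addOne φ w) = addOne φ ((φ ^ (i + 1)) w) := by
      rw [addOne_apply, addOne_apply, map_add, ← LinearEquiv.mul_apply, ← pow_succ, pow_succ' φ,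
        pow_succ' φ i]
      rfl
    rw [h1, hφ.polar_addOne_addOne, addInv_apply, QuadraticMap.polar_add_left]
    have h2 : φ.symm ((φ ^ (i + 1)) w) = (φ ^ i) w := by
      rw [pow_succ', LinearEquiv.mul_apply, φ.symm_apply_apply]
    rw [h2, add_sub_cancel_right, pow_succ' φ (i + 1)]
    rfl
  have hnat : ∀ i l : ℕ,
      QuadraticMap.polar Q ((φ ^ i) ((addOne φ ^ l) x)) ((addOne φ ^ l) x) =
        QuadraticMap.polar Q ((φ ^ i) ((addOne φ ^ l) y)) ((addOne φ ^ l) y) := by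
    intro i
    induction i using Nat.strong_induction_on with
    | _ i ih =>
      match i with
      | 0 => exact fun l => (polar_self_of_charTwo Q _).trans (polar_self_of_charTwo Q _).symm
      | 1 =>
        intro l
        rw [pow_one, ← hφ.map_addOne, ← hφ.map_addOne]
        have h := hxy (l + 1)
        rwa [pow_succ'] at h
      | i + 2 =>
        intro l
        have h := ih (i + 1) (by omega) (l + 1)
        rw [pow_succ' (addOne φ)] at h
        rw [hrec, hrec, ih i (by omega) l]
        exact congrArg (· - _) h
  obtain ⟨i, rfl | rfl⟩ := k.eq_nat_or_neg
  · rw [zpow_natCast]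
    exact hnat i 0
  · have h : ∀ w, QuadraticMap.polar Q ((φ ^ (-(i : ℤ))) w) w = QuadraticMap.polar Q ((φ ^ i) w) w :=
      fun w => by
        rw [← (hφ.zpow i).polar_apply, ← zpow_add_apply, add_neg_cancel, zpow_zero,
          QuadraticMap.polar_comm, zpow_natCast]
        rfl
    rw [h, h]
    exact hnat i 0

theorem addOne_sum_apply (hn : addOne φ ^ (n + 1) = 0) (v : V) :
    φ.symm v = aeval (addOne φ) (∑ i ∈ Finset.range (n + 1), X ^ i : K[X]) v := by
  have h1 : (X - 1 : K[X]) * ∑ i ∈ Finset.range (n + 1), X ^ i = X ^ (n + 1) - 1 := mul_geom_sum _ _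
  have h2 := LinearMap.congr_fun (congrArg (aeval (addOne φ)) h1) v
  rw [aeval_mul, map_sub, map_sub, map_pow, aeval_X, hn, map_one, Module.End.mul_apply,
    LinearMap.sub_apply, addOne_apply, Module.End.one_apply, add_sub_cancel_right, zero_sub,
    LinearMap.neg_apply, Module.End.one_apply, neg_eq_of_charTwo K] at h2
  rw [LinearEquiv.symm_apply_eq, h2]

theorem exists_aeval_of_mem_span_zpow (hn : addOne φ ^ (n + 1) = 0) {x v : V}
    (hv : v ∈ Submodule.span K (Set.range fun k : ℤ => (φ ^ k) x)) :
    ∃ p : K[X], v = aeval (addOne φ) p x := by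
  induction hv using Submodule.span_induction with
  | mem v hv =>
    obtain ⟨k, rfl⟩ := hv
    induction k using Int.induction_on with
    | zero => exact ⟨1, by simp⟩
    | succ k ih =>
      obtain ⟨p, hp⟩ := ih
      dsimp only at hp ⊢
      refine ⟨(X - 1) * p, ?_⟩
      rw [aeval_mul, Module.End.mul_apply, ← hp, ← zpow_one_add_apply, map_sub, aeval_X, map_one,
        LinearMap.sub_apply, addOne_apply, Module.End.one_apply, add_sub_cancel_right]
    | pred k ih =>
      obtain ⟨p, hp⟩ := ih
      dsimp only at hp ⊢
      refine ⟨(∑ i ∈ Finset.range (n + 1), X ^ i) * p, ?_⟩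
      rw [aeval_mul, Module.End.mul_apply, ← hp, ← symm_zpow_apply, addOne_sum_apply hn]
  | zero => exact ⟨0, by simp⟩
  | add v w _ _ hv hw =>
    obtain ⟨p, rfl⟩ := hv
    obtain ⟨q, rfl⟩ := hw
    exact ⟨p + q, by simp⟩
  | smul c v _ hv =>
    obtain ⟨p, rfl⟩ := hv
    exact ⟨c • p, by simp⟩

end Unipotent

section Bicyclic

variable [Field K] [CharP K 2] [AddCommGroup V] [Module K V]

theorem Nondefective.isReversible_of_bicyclic [FiniteDimensional K V]
    {Q : QuadraticForm K V} (hQ : Nondefective Q) {φ : V ≃ₗ[K] V} (hφ : InO Q φ)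
    (ih : ∀ (U : Submodule K V) (ψ : U ≃ₗ[K] U), finrank K U < finrank K V →
      Nondefective (Q.comp U.subtype) → InO (Q.comp U.subtype) ψ →
      IsReversible (Q.comp U.subtype) ψ)
    {m : ℕ} (hm : ∀ x, QuadraticMap.polar Q ((addInv φ ^ m) (φ x)) x = 0)
    (hs : addInv φ ^ (m + 1) = 0) (hs' : addInv φ ^ m ≠ 0) : IsReversible Q φ := by
  have hu : addOne φ ^ (2 * (m + 1)) = 0 := by rw [addOne_pow_two_mul, hs, mul_zero]
  obtain ⟨n, hn, hn'⟩ : ∃ n, addOne φ ^ (n + 1) = 0 ∧ addOne φ ^ n ≠ 0 := by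
    classical
    have hex : ∃ k, addOne φ ^ k = 0 := ⟨_, hu⟩
    have hpos : Nat.find hex ≠ 0 := fun h => by
      have h1 := Nat.find_spec hex
      rw [h, pow_zero] at h1
      exact hs' (by rw [← mul_one (addInv φ ^ m), h1, mul_zero])
    obtain ⟨n, hn⟩ := Nat.exists_eq_succ_of_ne_zero hpos
    have h1 := Nat.find_spec hex
    rw [hn] at h1
    exact ⟨n, h1, Nat.find_min hex (by omega)⟩
  have hmn : n = 2 * m ∨ n = 2 * m + 1 := by
    have h1 : ¬ n < 2 * m := fun h => hs' <| LinearMap.ext fun x => hQ _ fun y => by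
      change QuadraticMap.polar Q ((addInv φ ^ m) x) y = 0
      rw [← hφ.polar_addOne_pow, hφ.polar_pow_pow_eq_zero hn (by omega)]
    have h2 : ¬ 2 * (m + 1) ≤ n := fun h => hn' (pow_eq_zero_of_le h hu)
    omega
  obtain ⟨x, y, hxy, hQxy⟩ := hφ.exists_pair hQ hm hn hn' hmn
  have hyx : QuadraticMap.polar Q y ((addOne φ ^ n) x) ≠ 0 := by rwa [hφ.polar_pow_comm hn]
  have hdvd : ∀ {p q : K[X]}, (∀ i, QuadraticMap.polar Q x
        ((addOne φ ^ i) (aeval (addOne φ) p x + aeval (addOne φ) q y)) = 0 ∧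
      QuadraticMap.polar Q y
        ((addOne φ ^ i) (aeval (addOne φ) p x + aeval (addOne φ) q y)) = 0) →
      aeval (addOne φ) p x = 0 ∧ aeval (addOne φ) q y = 0 := by
    intro p q h
    obtain ⟨⟨p', hp⟩, ⟨q', hq⟩⟩ := X_pow_dvd_of_bicyclic hn (hφ.polar_self_pow hm hn hmn x)
      (hφ.polar_self_pow hm hn hmn y) hxy hyx h
    rw [hp, hq, aeval_mul, aeval_mul, map_pow, aeval_X, hn, zero_mul]
    exact ⟨rfl, rfl⟩
  have hgram := hφ.polar_iterate_eq hQxy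
  have hpol : ∀ (k l : ℤ) (v w : V), QuadraticMap.polar Q ((φ ^ k) v) ((φ ^ l) w) =
      QuadraticMap.polar Q ((φ ^ (k - l)) v) w := fun k l v w => by
    rw [← (hφ.zpow l).polar_apply ((φ ^ (k - l)) v), ← zpow_add_apply, add_sub_cancel]
  have hself : ∀ (k l : ℤ) (v : V), QuadraticMap.polar Q ((φ ^ k) v) ((φ ^ l) v) =
      QuadraticMap.polar Q ((φ ^ (-k)) v) ((φ ^ (-l)) v) := fun k l v => by
    rw [QuadraticMap.polar_comm, hpol, hpol]
    congr 3
    ring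
  set z : Bool → V := fun b => bif b then x else y with hz
  have hzQ : ∀ b, Q (z b) = Q (z !b) := by
    rintro (_ | _)
    · exact (hQxy 0).symm
    · exact hQxy 0
  have hzgram : ∀ b (k : ℤ), QuadraticMap.polar Q ((φ ^ k) (z b)) (z b) =
      QuadraticMap.polar Q ((φ ^ k) (z !b)) (z !b) := by
    rintro (_ | _) k
    · exact (hgram k).symm
    · exact hgram k
  set S : V → Submodule K V := fun v => Submodule.span K (Set.range fun k : ℤ => (φ ^ k) v) with hS
  set W := Submodule.span K (Set.range fun i : Bool × ℤ => (φ ^ i.2) (z i.1)) with hW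
  have hsplit : ∀ v ∈ W, ∃ a ∈ S x, ∃ b ∈ S y, a + b = v := by
    have hle : W ≤ S x ⊔ S y := by
      rw [hW, Submodule.span_le]
      rintro _ ⟨⟨_ | _, k⟩, rfl⟩
      · exact Submodule.mem_sup_right (Submodule.subset_span ⟨k, rfl⟩)
      · exact Submodule.mem_sup_left (Submodule.subset_span ⟨k, rfl⟩)
    exact fun v hv => Submodule.mem_sup.1 (hle hv)
  have hzW : ∀ b (k : ℤ), (φ ^ k) (z b) ∈ W := fun b k => Submodule.subset_span ⟨(b, k), rfl⟩
  refine hQ.isReversible_of_span hφ ih (w := fun i : Bool × ℤ => (φ ^ i.2) (z i.1))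
    (e := fun i => (!i.1, -i.2)) (r := fun i => (i.1, i.2 + 1)) (fun i => by simp)
    (fun i => by simp) (fun i => zpow_one_add_apply φ _ _)
    (fun i => by rw [hφ.zpow, hφ.zpow, hzQ]; simp) ?_ ⟨(true, 0), ?_⟩ ?_ ?_
  · rintro ⟨b, k⟩ ⟨c, l⟩
    dsimp only
    by_cases hbc : c = b
    · subst hbc
      rw [hself k l, hpol, hpol, hzgram c]
    · obtain rfl : c = !b := by
        cases b <;> cases c <;> simp_all
      rw [Bool.not_not, ← (hφ.zpow (k + l)).polar_apply, ← zpow_add_apply, ← zpow_add_apply,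
        QuadraticMap.polar_comm, add_neg_cancel_right, add_comm k l, add_neg_cancel_right]
  · intro h
    have h1 : x = 0 := h
    rw [h1, QuadraticMap.polar_zero_left] at hxy
    exact hxy rfl
  · intro v hv hvw
    have hstep : ∀ i, ∀ w ∈ W, QuadraticMap.polar Q w ((addOne φ ^ i) v) = 0 := by
      intro i
      induction i with
      | zero => exact fun w hw => (QuadraticMap.polar_comm Q _ _).trans (hvw w hw)
      | succ i hi =>
        have hWstable : ∀ w ∈ W, addOne φ (φ.symm w) ∈ W := by
          intro w hw
          induction hw using Submodule.span_induction with
          | mem v hv =>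
            obtain ⟨⟨b, k⟩, rfl⟩ := hv
            dsimp only
            rw [addOne_apply, φ.apply_symm_apply, symm_zpow_apply]
            exact W.add_mem (hzW b k) (hzW b (k - 1))
          | zero => simp
          | add v w _ _ hv hw => simpa only [map_add] using W.add_mem hv hw
          | smul c v _ hv => simpa only [map_smul] using W.smul_mem c hv
        intro w hw
        rw [QuadraticMap.polar_comm, pow_succ', Module.End.mul_apply, hφ.polar_addOne,
          QuadraticMap.polar_comm]
        exact hi _ (hWstable w hw)
    obtain ⟨a, ha, b, hb, rfl⟩ := hsplit v hv
    obtain ⟨p, rfl⟩ := exists_aeval_of_mem_span_zpow hn ha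
    obtain ⟨q, rfl⟩ := exists_aeval_of_mem_span_zpow hn hb
    obtain ⟨h1, h2⟩ := hdvd fun i => ⟨hstep i x (hzW true 0), hstep i y (hzW false 0)⟩
    rw [h1, h2, add_zero]
  · intro σ hσ v hv hσv
    obtain ⟨a, ha, b, hb, rfl⟩ := hsplit v hv
    have hσx : ∀ a ∈ S x, σ a ∈ S y := by
      have hle : S x ≤ (S y).comap σ := by
        rw [hS, Submodule.span_le]
        rintro _ ⟨k, rfl⟩
        exact Submodule.subset_span ⟨-k, (hσ (true, k)).symm⟩
      exact fun a ha => hle ha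
    have hσy : ∀ b ∈ S y, σ b ∈ S x := by
      have hle : S y ≤ (S x).comap σ := by
        rw [hS, Submodule.span_le]
        rintro _ ⟨k, rfl⟩
        exact Submodule.subset_span ⟨-k, (hσ (false, k)).symm⟩
      exact fun a ha => hle ha
    have h1 : (a - σ b) + (b - σ a) = 0 := by
      rw [sub_add_sub_comm, ← map_add, add_comm b a, hσv, sub_self]
    obtain ⟨p, hp⟩ := exists_aeval_of_mem_span_zpow hn ((S x).sub_mem ha (hσy b hb))
    obtain ⟨q, hq⟩ := exists_aeval_of_mem_span_zpow hn ((S y).sub_mem hb (hσx a ha))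
    rw [hp, hq] at h1
    obtain ⟨-, h2⟩ := hdvd fun i => by
      rw [h1, map_zero, QuadraticMap.polar_zero_right, QuadraticMap.polar_zero_right]
      exact ⟨rfl, rfl⟩
    rw [← hq, sub_eq_zero] at h2
    exact ⟨a, by rw [h2]⟩

end Bicyclic

section Existence

variable [Field K] [AddCommGroup V] [Module K V]

theorem Nondefective.exists_cyclic_or_dvd_X [FiniteDimensional K V]
    {Q : QuadraticForm K V} (hQ : Nondefective Q) {φ : V ≃ₗ[K] V} (hφ : InO Q φ) {π : K[X]}
    (hπ : Irreducible π) (hdvd : π ∣ minpoly K (addInv φ)) :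
    π ∣ X ∨ ∃ (n : ℕ) (x : V), aeval (addInv φ) (π ^ (n + 1)) x = 0 ∧
      QuadraticMap.polar Q (aeval (addInv φ) (π ^ n * 1) (φ x)) x ≠ 0 := by
  have hμ : minpoly K (addInv φ) ≠ 0 := minpoly.ne_zero (Algebra.IsIntegral.isIntegral _)
  obtain ⟨ρ, hk, hρ⟩ :=
    (FiniteMultiplicity.of_not_isUnit hπ.not_isUnit hμ).exists_eq_pow_mul_and_not_dvd
  obtain ⟨n, hn⟩ : ∃ n, multiplicity π (minpoly K (addInv φ)) = n + 1 :=
    Nat.exists_eq_succ_of_ne_zero fun h => hρ (by rwa [hk, h, pow_zero, one_mul] at hdvd)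
  rw [hn] at hk
  by_contra! hcon
  obtain ⟨hX, hcon⟩ := hcon
  have hsa := polar_aeval hφ.polar_addInv
  have hquad : ∀ x, QuadraticMap.polar Q (aeval (addInv φ) (ρ * π ^ n * ρ) (φ x)) x = 0 := fun x => by
    have h1 := hcon n (aeval (addInv φ) ρ x) (by
      rw [← Module.End.mul_apply, ← aeval_mul, ← hk, minpoly.aeval, LinearMap.zero_apply])
    rwa [← hsa, mul_one, ← aeval_addInv_apply_comm, ← Module.End.mul_apply, ← aeval_mul,
      ← Module.End.mul_apply, ← aeval_mul] at h1
  have hzero : aeval (addInv φ) (X * (ρ * π ^ n * ρ)) = 0 := LinearMap.ext fun x => hQ _ fun y => by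
    have h1 := hquad (x + y)
    rw [map_add, map_add, QuadraticMap.polar_add_left, QuadraticMap.polar_add_right,
      QuadraticMap.polar_add_right, hquad, hquad, zero_add, add_zero, hsa _ (φ y),
      QuadraticMap.polar_comm Q (φ y), ← hφ.polar_symm_apply, ← QuadraticMap.polar_add_left,
      aeval_addInv_apply_comm, ← addInv_apply] at h1
    rw [aeval_mul, aeval_X]
    exact h1
  have h2 := minpoly.dvd K _ hzero
  rw [hk, pow_succ, show X * (ρ * π ^ n * ρ) = π ^ n * (X * ρ * ρ) by ring, mul_assoc] at h2
  have h3 := (dvd_mul_right π ρ).trans ((mul_dvd_mul_iff_left (pow_ne_zero n hπ.ne_zero)).1 h2)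
  rcases hπ.prime.dvd_or_dvd h3 with h | h
  · rcases hπ.prime.dvd_or_dvd h with h | h
    · exact hX h
    · exact hρ h
  · exact hρ h

end Existence

section Reversible

universe u v

theorem Nondefective.isReversible {K : Type u} [Field K] [CharP K 2] {V : Type v} [AddCommGroup V]
    [Module K V] [FiniteDimensional K V] {Q : QuadraticForm K V} (hQ : Nondefective Q)
    {φ : V ≃ₗ[K] V} (hφ : InO Q φ) : IsReversible Q φ := by
  induction hd : finrank K V using Nat.strong_induction_on generalizing V with
  | _ d ih =>
    subst hd
    have ih' : ∀ (U : Submodule K V) (ψ : U ≃ₗ[K] U), finrank K U < finrank K V →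
        Nondefective (Q.comp U.subtype) → InO (Q.comp U.subtype) ψ →
        IsReversible (Q.comp U.subtype) ψ :=
      fun U ψ hlt hU hψ => ih _ hlt hU hψ rfl
    rcases subsingleton_or_nontrivial V with hV | hV
    · exact ⟨LinearMap.id, fun _ => rfl, fun _ => rfl, fun _ => Subsingleton.elim _ _,
        fun v _ => ⟨v, Subsingleton.elim _ _⟩⟩
    by_cases hcyc : ∃ π : K[X], Irreducible π ∧ ∃ (n : ℕ) (x : V),
        aeval (addInv φ) (π ^ (n + 1)) x = 0 ∧
        QuadraticMap.polar Q (aeval (addInv φ) (π ^ n * 1) (φ x)) x ≠ 0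
    · obtain ⟨π, hπ, n, x, hx, hne⟩ := hcyc
      exact hQ.isReversible_of_cyclic hφ ih' hπ hx hne
    push Not at hcyc
    have hμ : minpoly K (addInv φ) ≠ 0 := minpoly.ne_zero (Algebra.IsIntegral.isIntegral _)
    obtain ⟨ρ, hk, hρ⟩ :=
      (FiniteMultiplicity.of_not_isUnit irreducible_X.not_isUnit hμ).exists_eq_pow_mul_and_not_dvd
    have hunit : IsUnit ρ := by
      by_contra hunit
      have hρ0 : ρ ≠ 0 := fun h => hρ (h ▸ dvd_zero _)
      obtain ⟨π, hπ, hdvd⟩ := WfDvdMonoid.exists_irreducible_factor hunit hρ0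
      rcases hQ.exists_cyclic_or_dvd_X hφ hπ (hdvd.trans (hk ▸ dvd_mul_left _ _)) with h | h
      · exact hρ (((hπ.dvd_comm irreducible_X).1 h).trans hdvd)
      · obtain ⟨n, x, hx, hne⟩ := h
        exact hne (hcyc π hπ n x hx)
    have hnil : IsNilpotent (addInv φ) := by
      refine ⟨multiplicity X (minpoly K (addInv φ)), ?_⟩
      have h1 := minpoly.aeval K (addInv φ)
      rw [hk, aeval_mul, map_pow, aeval_X] at h1
      exact (hunit.map (aeval (R := K) (addInv φ))).mul_left_eq_zero.1 h1
    obtain ⟨m, hm, hm'⟩ : ∃ m, addInv φ ^ (m + 1) = 0 ∧ addInv φ ^ m ≠ 0 := by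
      classical
      have hpos : Nat.find hnil ≠ 0 := fun h => by
        have h1 := Nat.find_spec hnil
        rw [h, pow_zero] at h1
        exact one_ne_zero h1
      obtain ⟨n, hn⟩ := Nat.exists_eq_succ_of_ne_zero hpos
      have h1 := Nat.find_spec hnil
      rw [hn] at h1
      exact ⟨n, h1, Nat.find_min hnil (by omega)⟩
    refine hQ.isReversible_of_bicyclic hφ ih' (fun x => ?_) hm hm'
    have h1 := hcyc X irreducible_X m x (by rw [map_pow, aeval_X, hm, LinearMap.zero_apply])
    rwa [mul_one, map_pow, aeval_X] at h1

end Reversible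

section Main

variable [Field K] [AddCommGroup V] [Module K V]

theorem polar_sub_id_of_involutive {Q : QuadraticForm K V} {σ : V ≃ₗ[K] V} (hσ : InO Q σ)
    (hσ2 : ∀ v, σ (σ v) = v) (x y : V) :
    QuadraticMap.polar Q ((σ.toLinearMap - LinearMap.id : V →ₗ[K] V) x) y =
      QuadraticMap.polar Q x ((σ.toLinearMap - LinearMap.id : V →ₗ[K] V) y) := by
  change QuadraticMap.polar Q (σ x - x) y = QuadraticMap.polar Q x (σ y - y)
  rw [QuadraticMap.polar_sub_left, QuadraticMap.polar_sub_right, ← hσ.polar_apply (σ x), hσ2]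

variable [CharP K 2]

theorem polar_self_sub_id {Q : QuadraticForm K V} {σ : V ≃ₗ[K] V} (hσ : InO Q σ) (x : V) :
    QuadraticMap.polar Q x ((σ.toLinearMap - LinearMap.id : V →ₗ[K] V) x) =
      Q ((σ.toLinearMap - LinearMap.id : V →ₗ[K] V) x) := by
  change QuadraticMap.polar Q x (σ x - x) = Q (σ x - x)
  rw [sub_eq_add_neg, neg_eq_of_charTwo K, QuadraticMap.map_add Q, hσ, CharTwo.add_self_eq_zero,
    zero_add, QuadraticMap.polar_add_right, polar_self_of_charTwo, add_zero,
    QuadraticMap.polar_comm]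

theorem Nondefective.bireflSO [FiniteDimensional K V] {Q : QuadraticForm K V}
    (hQ : Nondefective Q) (hdim : finrank K V % 4 = 0) {φ : V ≃ₗ[K] V} (hφ : InSO Q φ) :
    BireflSO Q φ := by
  obtain ⟨σ', hσQ, hσ2, hσφ, hσfix⟩ := hQ.isReversible hφ.1
  obtain ⟨σ, hσ⟩ : ∃ σ : V ≃ₗ[K] V, ∀ v, σ v = σ' v :=
    ⟨LinearEquiv.ofInvolutive σ' hσ2, fun _ => rfl⟩
  have hσO : InO Q σ := fun v => by rw [hσ, hσQ]
  have hσσ : ∀ v, σ (σ v) = v := fun v => by rw [hσ, hσ, hσ2]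
  have hτO : InO Q (σ * φ) := fun v => by rw [LinearEquiv.mul_apply, hσO, hφ.1]
  have hττ : ∀ v, (σ * φ) ((σ * φ) v) = v := fun v => by
    rw [LinearEquiv.mul_apply, LinearEquiv.mul_apply, hσ, hσ, hσφ]
  have hσ1 : σ * σ = 1 := LinearEquiv.ext hσσ
  have hσeven : Even (finrank K (LinearMap.range (σ.toLinearMap - LinearMap.id))) := by
    have h1 : LinearMap.range (σ.toLinearMap - LinearMap.id) =
        LinearMap.ker (σ.toLinearMap - LinearMap.id) := by
      refine le_antisymm (range_sub_id_le_ker hσ1) fun v hv => ?_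
      have hv' : σ' v = v := by
        rw [← hσ]
        exact sub_eq_zero.1 hv
      obtain ⟨y, hy⟩ := hσfix v hv'
      refine ⟨y, ?_⟩
      change σ y - y = v
      rw [hy, hσ, sub_eq_add_neg, neg_eq_of_charTwo K, add_comm]
    have h2 := LinearMap.finrank_range_add_finrank_ker (σ.toLinearMap - LinearMap.id)
    rw [← h1] at h2
    rw [Nat.even_iff]
    omega
  have hsum : LinearMap.range ((σ.toLinearMap - LinearMap.id) +
      ((σ * φ).toLinearMap - LinearMap.id)) =
      (LinearMap.range (φ.toLinearMap - LinearMap.id)).map σ.toLinearMap := by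
    rw [← LinearMap.range_comp]
    congr 1
    ext v
    change σ v - v + (σ (φ v) - v) = σ (φ v - v)
    rw [map_sub, sub_eq_add_neg _ v, sub_eq_add_neg _ v, neg_eq_of_charTwo K v, sub_eq_add_neg,
      neg_eq_of_charTwo K (σ v), add_add_add_comm, add_self_of_charTwo K v, add_zero, add_comm]
  have hτeven : Even (finrank K (LinearMap.range ((σ * φ).toLinearMap - LinearMap.id))) := by
    have h1 := hQ.even_finrank_range_add (polar_sub_id_of_involutive hσO hσσ)
      (polar_sub_id_of_involutive hτO hττ) (polar_self_sub_id hσO) (polar_self_sub_id hτO)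
    rw [hsum, LinearEquiv.finrank_map_eq] at h1
    have h2 := hφ.2
    rw [Nat.even_iff] at h1 h2 hσeven ⊢
    omega
  refine ⟨σ, σ * φ, ⟨hσO, hσeven⟩, ⟨hτO, hτeven⟩, hσ1, LinearEquiv.ext hττ, ?_⟩
  rw [← mul_assoc, hσ1, one_mul]

end Main

theorem stmt2 [Field K] [AddCommGroup V] [Module K V] [FiniteDimensional K V]
    (Q : QuadraticForm K V) (hQ : Nondefective Q)
    (hchar : ringChar K = 2) (hdim : 4 ≤ Module.finrank K V) :
    (∀ φ : V ≃ₗ[K] V, InSO Q φ → BireflSO Q φ) ↔ Module.finrank K V % 4 = 0 := by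
  have : CharP K 2 := ringChar.of_eq hchar
  refine ⟨fun h => ?_, fun h φ hφ => hQ.bireflSO h hφ⟩
  obtain ⟨φ, hφ, hfix⟩ := hQ.exists_isometry_fixed_eq_zero (by omega)
  refine four_dvd_finrank_of_bireflSO hfix (h φ ⟨hφ, ?_⟩)
  have hinj : Function.Injective (φ.toLinearMap - LinearMap.id : V →ₗ[K] V) := by
    rw [← LinearMap.ker_eq_bot, LinearMap.ker_eq_bot']
    exact fun v hv => hfix v (sub_eq_zero.1 hv)
  rw [LinearMap.finrank_range_of_inj hinj]
  exact hQ.even_finrank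
end
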